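/- Let n ≥ 3, let α, β, γ, ν, μ be real numbers and let 1 < p ≤ q < ∞. Assume ν/p′ + μ/q > 0. Then the operator S = S_{α,β,γ} is bounded from L^p_ν(Λ_n) into L^q_μ(Λ_n) if and only if the parameters satisfy all three of: (i) γ = α + β + n/2 − ν/p + μ/q; (ii) p(β − γ + n − 1) − n/2 + 1 < ν < p(β + 1) + n/2 − 1; (iii) n/2 − 1 − qα < μ < q(γ − α) − n/2 + 1. (This is the paper's Theorem 2.1 instantiated on the rank-2 Lorentz cone, where n/r = n/2 and 2(n/r) − 1 = n − 1.) -/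

import Mathlib

open MeasureTheory ENNReal

noncomputable section

/-- The Lorentz determinant `Δ(y) = y₁² − y₂² − ⋯ − y_n²`. -/
def lDelta (n : ℕ) [NeZero n] (y : Fin n → ℝ) : ℝ :=
  2 * y 0 ^ 2 - ∑ i, y i ^ 2

/-- The Lorentz cone `Λ_n`. -/
def lCone (n : ℕ) [NeZero n] : Set (Fin n → ℝ) :=
  {y | 0 < lDelta n y ∧ 0 < y 0}

/-- The `L^p_ν(Λ_n)` norm `(∫_{Λ_n} |g(y)|^p Δ(y)^{ν−n/2} dy)^{1/p}`. -/
def coneNorm (n : ℕ) [NeZero n] (p ν : ℝ) (g : (Fin n → ℝ) → ℝ) : ℝ≥0∞ :=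
  (∫⁻ y in lCone n, ENNReal.ofReal (|g y| ^ p * lDelta n y ^ (ν - (n : ℝ) / 2))) ^ (1 / p)

/-- The operator `S_{α,β,γ}` applied to `|g|`:
`S|g|(y) = Δ(y)^α ∫_{Λ_n} Δ(y+x)^{−γ} |g(x)| Δ(x)^β dx`. -/
def Sop (n : ℕ) [NeZero n] (α β γ : ℝ) (g : (Fin n → ℝ) → ℝ) (y : Fin n → ℝ) : ℝ≥0∞ :=
  ENNReal.ofReal (lDelta n y ^ α) *
    ∫⁻ x in lCone n, ENNReal.ofReal (lDelta n (y + x) ^ (-γ) * |g x| * lDelta n x ^ β)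

/-- The `L^q_μ(Λ_n)` norm of `S_{α,β,γ}|g|`. -/
def SopNorm (n : ℕ) [NeZero n] (α β γ q μ : ℝ) (g : (Fin n → ℝ) → ℝ) : ℝ≥0∞ :=
  (∫⁻ y in lCone n, Sop n α β γ g y ^ q * ENNReal.ofReal (lDelta n y ^ (μ - (n : ℝ) / 2))) ^ (1 / q)

/-- `S_{α,β,γ}` is bounded from `L^p_ν(Λ_n)` to `L^q_μ(Λ_n)`:
`‖S|g|‖_{q,μ} ≤ C ‖g‖_{p,ν}` for every `g ∈ L^p_ν(Λ_n)`. -/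
def SBounded (n : ℕ) [NeZero n] (α β γ p ν q μ : ℝ) : Prop :=
  ∃ C > (0 : ℝ), ∀ g : (Fin n → ℝ) → ℝ, Measurable g → coneNorm n p ν g < ⊤ →
    SopNorm n α β γ q μ g ≤ ENNReal.ofReal C * coneNorm n p ν g

theorem lintegral_eq_ofReal_mul_lintegral_comp_smul {E : Type*} [NormedAddCommGroup E]
    [NormedSpace ℝ E] [MeasurableSpace E] [BorelSpace E] [FiniteDimensional ℝ E]
    (μ : Measure E) [μ.IsAddHaarMeasure] {r : ℝ} (hr : 0 < r) (f : E → ℝ≥0∞) :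
    ∫⁻ x, f x ∂μ = ENNReal.ofReal (r ^ Module.finrank ℝ E) * ∫⁻ x, f (r • x) ∂μ := by
  have h1 : ∫⁻ x, f (r • x) ∂μ = ∫⁻ x, f x ∂(Measure.map (fun x => r • x) μ) :=
    ((measurableEmbedding_const_smul₀ hr.ne').lintegral_map f).symm
  have hpos : 0 < r ^ Module.finrank ℝ E := by positivity
  rw [h1, Measure.map_addHaar_smul μ hr.ne', lintegral_smul_measure, smul_eq_mul, ← mul_assoc,
    ← ENNReal.ofReal_mul hpos.le, abs_of_pos (by positivity), mul_inv_cancel₀ hpos.ne',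
    ENNReal.ofReal_one, one_mul]

theorem rpow_le_mul_rpow_of_le_mul {c x y : ℝ} (hc : 1 ≤ c) (hx : 0 < x) (hy : 0 < y)
    (hxy : x ≤ c * y) (hyx : y ≤ c * x) (e : ℝ) : y ^ e ≤ c ^ |e| * x ^ e := by
  have hc0 : 0 < c := by linarith
  rcases le_total 0 e with he | he
  · rw [abs_of_nonneg he, ← Real.mul_rpow hc0.le hx.le]
    exact Real.rpow_le_rpow hy.le hyx he
  · rw [abs_of_nonpos he, Real.rpow_neg hc0.le, ← Real.inv_rpow hc0.le,
      ← Real.mul_rpow (by positivity) hx.le]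
    refine Real.rpow_le_rpow_of_nonpos (by positivity) ?_ he
    rw [inv_mul_le_iff₀ hc0]
    exact hxy

/-- The Beta-type integral `∫₀^∞ t^(a-1) (1+t)^(-d) dt`. -/
def betaInt (a d : ℝ) : ℝ≥0∞ :=
  ∫⁻ t in Set.Ioi (0 : ℝ), ENNReal.ofReal (t ^ (a - 1) * (1 + t) ^ (-d))

theorem betaInt_ne_zero (a d : ℝ) : betaInt a d ≠ 0 := by
  have hm : Measurable fun t : ℝ => ENNReal.ofReal (t ^ (a - 1) * (1 + t) ^ (-d)) := by fun_prop
  refine ((setLIntegral_pos_iff hm).2 ?_).ne'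
  have : Set.Ioi (0 : ℝ) ⊆
      Function.support (fun t : ℝ => ENNReal.ofReal (t ^ (a - 1) * (1 + t) ^ (-d))) ∩
        Set.Ioi 0 := by
    intro t ht
    have ht' : 0 < t := ht
    refine ⟨?_, ht⟩
    simp only [Function.mem_support, ne_eq, ENNReal.ofReal_eq_zero, not_le]
    positivity
  exact lt_of_lt_of_le (by simp) (measure_mono this)

theorem integrableOn_iff_setLIntegral_lt_top {s : Set ℝ} (hs : MeasurableSet s) {f : ℝ → ℝ}
    (hf : Measurable f) (h0 : ∀ t ∈ s, 0 ≤ f t) :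
    IntegrableOn f s ↔ ∫⁻ t in s, ENNReal.ofReal (f t) < ⊤ := by
  rw [IntegrableOn, Integrable, and_iff_right hf.aestronglyMeasurable,
    hasFiniteIntegral_iff_ofReal (ae_restrict_of_forall_mem hs h0)]

theorem setLIntegral_lt_top_of_le_mul {s : Set ℝ} {f g : ℝ → ℝ}
    (hg : Measurable g) {c : ℝ} (hc : 0 ≤ c) (hfg : ∀ t ∈ s, f t ≤ c * g t)
    (hfin : ∫⁻ t in s, ENNReal.ofReal (g t) < ⊤) :
    ∫⁻ t in s, ENNReal.ofReal (f t) < ⊤ := by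
  have : ∫⁻ t in s, ENNReal.ofReal (f t) ≤ ENNReal.ofReal c * ∫⁻ t in s, ENNReal.ofReal (g t) := by
    rw [← lintegral_const_mul _ hg.ennreal_ofReal]
    refine setLIntegral_mono (by fun_prop) fun t ht => ?_
    rw [← ENNReal.ofReal_mul hc]
    exact ENNReal.ofReal_le_ofReal (hfg t ht)
  exact this.trans_lt (ENNReal.mul_lt_top ENNReal.ofReal_lt_top hfin)

theorem betaInt_lt_top_iff (a d : ℝ) : betaInt a d < ⊤ ↔ 0 < a ∧ a < d := by
  have hf : Measurable fun t : ℝ => t ^ (a - 1) * (1 + t) ^ (-d) := by fun_prop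
  have hsplit : betaInt a d < ⊤ ↔
      (∫⁻ t in Set.Ioo (0 : ℝ) 1, ENNReal.ofReal (t ^ (a - 1) * (1 + t) ^ (-d)) < ⊤) ∧
      (∫⁻ t in Set.Ioi (1 : ℝ), ENNReal.ofReal (t ^ (a - 1) * (1 + t) ^ (-d)) < ⊤) := by
    have : betaInt a d =
      (∫⁻ t in Set.Ioo (0 : ℝ) 1, ENNReal.ofReal (t ^ (a - 1) * (1 + t) ^ (-d))) +
      (∫⁻ t in Set.Ioi (1 : ℝ), ENNReal.ofReal (t ^ (a - 1) * (1 + t) ^ (-d))) := by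
      rw [betaInt, ← Set.Ioc_union_Ioi_eq_Ioi (zero_le_one (α := ℝ)),
        lintegral_union measurableSet_Ioi (Set.Ioc_disjoint_Ioi le_rfl),
        setLIntegral_congr Ioo_ae_eq_Ioc]
    rw [this, ENNReal.add_lt_top]
  have h01 : (∫⁻ t in Set.Ioo (0 : ℝ) 1, ENNReal.ofReal (t ^ (a - 1) * (1 + t) ^ (-d)) < ⊤) ↔
      0 < a := by
    have key : ∫⁻ t in Set.Ioo (0 : ℝ) 1, ENNReal.ofReal (t ^ (a - 1)) < ⊤ ↔ 0 < a := by
      rw [← integrableOn_iff_setLIntegral_lt_top measurableSet_Ioo (by fun_prop)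
        (fun t ht => Real.rpow_nonneg ht.1.le _),
        intervalIntegral.integrableOn_Ioo_rpow_iff one_pos]
      constructor <;> intro h <;> linarith
    rw [← key]
    have hb : ∀ t ∈ Set.Ioo (0 : ℝ) 1, (1 + t) ^ (-d) ≤ 2 ^ |(-d)| * 1 ^ (-d) ∧
        (1 : ℝ) ^ (-d) ≤ 2 ^ |(-d)| * (1 + t) ^ (-d) := by
      rintro t ⟨h0, h1⟩
      constructor <;> apply rpow_le_mul_rpow_of_le_mul <;> linarith
    constructor
    · refine setLIntegral_lt_top_of_le_mul hf (c := 2 ^ |(-d)|) (by positivity) fun t ht => ?_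
      have := mul_le_mul_of_nonneg_left (hb t ht).2 (Real.rpow_nonneg ht.1.le (a - 1))
      rw [Real.one_rpow] at this
      linarith
    · refine setLIntegral_lt_top_of_le_mul (by fun_prop) (c := 2 ^ |(-d)|) (by positivity)
        fun t ht => ?_
      have := mul_le_mul_of_nonneg_left (hb t ht).1 (Real.rpow_nonneg ht.1.le (a - 1))
      rw [Real.one_rpow] at this
      linarith
  have h1 : (∫⁻ t in Set.Ioi (1 : ℝ), ENNReal.ofReal (t ^ (a - 1) * (1 + t) ^ (-d)) < ⊤) ↔
      a < d := by
    have key : ∫⁻ t in Set.Ioi (1 : ℝ), ENNReal.ofReal (t ^ (a - 1 - d)) < ⊤ ↔ a < d := by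
      rw [← integrableOn_iff_setLIntegral_lt_top measurableSet_Ioi (by fun_prop)
        (fun t ht => Real.rpow_nonneg (zero_le_one.trans (le_of_lt ht)) _),
        integrableOn_Ioi_rpow_iff one_pos]
      constructor <;> intro h <;> linarith
    rw [← key]
    have hb : ∀ t ∈ Set.Ioi (1 : ℝ), (1 + t) ^ (-d) ≤ 2 ^ |(-d)| * t ^ (-d) ∧
        t ^ (-d) ≤ 2 ^ |(-d)| * (1 + t) ^ (-d) := by
      intro t (ht : 1 < t)
      constructor <;> apply rpow_le_mul_rpow_of_le_mul <;> linarith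
    have he : ∀ t ∈ Set.Ioi (1 : ℝ), t ^ (a - 1 - d) = t ^ (a - 1) * t ^ (-d) := by
      intro t (ht : 1 < t)
      rw [← Real.rpow_add (by linarith), sub_eq_add_neg]
    constructor
    · refine setLIntegral_lt_top_of_le_mul hf (c := 2 ^ |(-d)|) (by positivity) fun t ht => ?_
      have ht' : (1 : ℝ) < t := ht
      have := mul_le_mul_of_nonneg_left (hb t ht).2
        (Real.rpow_nonneg (by linarith : 0 ≤ t) (a - 1))
      rw [he t ht]
      linarith
    · refine setLIntegral_lt_top_of_le_mul (by fun_prop) (c := 2 ^ |(-d)|) (by positivity)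
        fun t ht => ?_
      have ht' : (1 : ℝ) < t := ht
      have := mul_le_mul_of_nonneg_left (hb t ht).1
        (Real.rpow_nonneg (by linarith : 0 ≤ t) (a - 1))
      rw [he t ht]
      linarith
  rw [hsplit, h01, h1]

theorem setLIntegral_Ioi_rpow_mul_add_rpow (a d : ℝ) {c : ℝ} (hc : 0 < c) :
    ∫⁻ t in Set.Ioi (0 : ℝ), ENNReal.ofReal (t ^ (a - 1) * (c + t) ^ (-d)) =
      ENNReal.ofReal (c ^ (a - d)) * betaInt a d := by
  have hm : Measurable ((Set.Ioi (0 : ℝ)).indicator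
      fun t : ℝ => ENNReal.ofReal (t ^ (a - 1) * (c + t) ^ (-d))) :=
    Measurable.indicator (by fun_prop) measurableSet_Ioi
  have hmc : Measurable fun t : ℝ => (Set.Ioi (0 : ℝ)).indicator
      (fun t : ℝ => ENNReal.ofReal (t ^ (a - 1) * (c + t) ^ (-d))) (c • t) :=
    hm.comp (measurable_const_smul c)
  rw [betaInt, ← lintegral_indicator measurableSet_Ioi, ← lintegral_indicator measurableSet_Ioi,
    lintegral_eq_ofReal_mul_lintegral_comp_smul volume hc,
    ← lintegral_const_mul _ (Measurable.indicator (by fun_prop) measurableSet_Ioi),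
    ← lintegral_const_mul _ hmc]
  congr 1 with t
  rw [smul_eq_mul]
  by_cases ht : 0 < t
  · rw [Set.indicator_of_mem (by simpa using mul_pos hc ht),
      Set.indicator_of_mem (by simpa using ht), ← ENNReal.ofReal_mul (by positivity),
      ← ENNReal.ofReal_mul (by positivity), Module.finrank_self, pow_one]
    congr 1
    rw [show c + c * t = c * (1 + t) by ring, Real.mul_rpow hc.le ht.le,
      Real.mul_rpow hc.le (by linarith), show a - d = 1 + (a - 1) + -d by ring,
      Real.rpow_add hc, Real.rpow_add hc, Real.rpow_one]
    ring
  · rw [Set.indicator_of_notMem (by simpa using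
      (mul_nonpos_of_nonneg_of_nonpos hc.le (not_lt.1 ht))), Set.indicator_of_notMem (by simpa using ht)]
    simp

/-- The integral `∫ (1 + |z|²)^(-C) dz` over `ℝ^k`. -/
def bracketInt (k : ℕ) (C : ℝ) : ℝ≥0∞ :=
  ∫⁻ z : Fin k → ℝ, ENNReal.ofReal ((1 + ∑ i, z i ^ 2) ^ (-C))

theorem bracketInt_ne_zero (k : ℕ) (C : ℝ) : bracketInt k C ≠ 0 := by
  have hm : Measurable fun z : Fin k → ℝ =>
      ENNReal.ofReal ((1 + ∑ i, z i ^ 2) ^ (-C)) := by fun_prop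
  refine ((lintegral_pos_iff_support hm).2 ?_).ne'
  have : Function.support (fun z : Fin k → ℝ =>
      ENNReal.ofReal ((1 + ∑ i, z i ^ 2) ^ (-C))) = Set.univ := by
    ext z
    have : 0 < 1 + ∑ i, z i ^ 2 := by positivity
    simp only [Function.mem_support, ne_eq, ENNReal.ofReal_eq_zero, not_le, Set.mem_univ, iff_true]
    positivity
  rw [this]
  exact Measure.measure_univ_pos.2 (NeZero.ne _)

theorem bracketInt_lt_top (k : ℕ) {C : ℝ} (hC : (k : ℝ) / 2 < C) : bracketInt k C < ⊤ := by
  have hint : Integrable (fun z : Fin k → ℝ => ((1 : ℝ) + ‖z‖ ^ 2) ^ (-(2 * C) / 2)) volume :=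
    integrable_rpow_neg_one_add_norm_sq (by rw [Module.finrank_fin_fun]; linarith)
  refine lt_of_le_of_lt (lintegral_mono fun z => ?_) hint.lintegral_lt_top
  refine ENNReal.ofReal_le_ofReal ?_
  have hC0 : 0 ≤ C := le_trans (by positivity) hC.le
  rw [show -(2 * C) / 2 = -C by ring]
  refine Real.rpow_le_rpow_of_nonpos (by positivity) ?_ (by linarith)
  have hnorm : ‖z‖ ≤ √(∑ i, z i ^ 2) := by
    refine (pi_norm_le_iff_of_nonneg (Real.sqrt_nonneg _)).2 fun i => ?_
    rw [Real.norm_eq_abs]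
    refine Real.abs_le_sqrt ?_
    exact Finset.single_le_sum (f := fun i => z i ^ 2) (fun i _ => sq_nonneg _) (Finset.mem_univ i)
  have := pow_le_pow_left₀ (norm_nonneg z) hnorm 2
  rw [Real.sq_sqrt (by positivity)] at this
  linarith

theorem lintegral_add_mul_sum_sq_rpow (k : ℕ) (C : ℝ) {P r : ℝ} (hP : 0 < P) (hr : 0 < r)
    (a : Fin k → ℝ) :
    ∫⁻ z : Fin k → ℝ, ENNReal.ofReal ((P + r * ∑ i, (z i - a i) ^ 2) ^ (-C)) =
      ENNReal.ofReal (P ^ (-C) * (P / r) ^ ((k : ℝ) / 2)) * bracketInt k C := by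
  have h1 := lintegral_sub_right_eq_self (μ := (volume : Measure (Fin k → ℝ)))
    (fun z : Fin k → ℝ => ENNReal.ofReal ((P + r * ∑ i, z i ^ 2) ^ (-C))) a
  simp only [Pi.sub_apply] at h1
  have hρ : 0 < √(P / r) := Real.sqrt_pos.2 (by positivity)
  rw [h1, lintegral_eq_ofReal_mul_lintegral_comp_smul volume hρ, bracketInt,
    ← lintegral_const_mul _ (by fun_prop), ← lintegral_const_mul _ (by fun_prop)]
  congr 1 with z
  rw [← ENNReal.ofReal_mul (by positivity), ← ENNReal.ofReal_mul (by positivity)]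
  congr 1
  have h2 : P + r * ∑ i, (√(P / r) • z) i ^ 2 = P * (1 + ∑ i, z i ^ 2) := by
    simp only [Pi.smul_apply, smul_eq_mul, mul_pow, Real.sq_sqrt (by positivity : 0 ≤ P / r)]
    rw [← Finset.mul_sum]
    field_simp
  rw [h2, Real.mul_rpow hP.le (by positivity), Module.finrank_fin_fun, Real.sqrt_eq_rpow,
    ← Real.rpow_natCast, ← Real.rpow_mul (by positivity),
    show 1 / 2 * (k : ℝ) = (k : ℝ) / 2 by ring]
  ring

/-- A weighted form of Young's inequality for integral operators with a positive kernel. -/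
theorem lintegral_kernel_rpow_le {X : Type*} [MeasurableSpace X] (μ : Measure X) [SFinite μ]
    {K : X → X → ℝ≥0∞} (hK : Measurable (Function.uncurry K)) {w f : X → ℝ≥0∞}
    (hw : Measurable w) (hf : Measurable f) (hKtop : ∀ y x, K y x ≠ ⊤)
    (hftop : ∀ x, f x ≠ ⊤) (hw0 : ∀ᵐ x ∂μ, w x ≠ 0) (hwtop : ∀ x, w x ≠ ⊤)
    {p p' q r : ℝ} (hp : 0 < p) (hp' : 0 < p') (hpp' : 1 / p + 1 / p' = 1) (hpq : p ≤ q)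
    (hr : 0 < r) (hrr : 1 / r = 1 / q + 1 / p') {M₁ M₂ : ℝ≥0∞}
    (h₁ : ∀ᵐ y ∂μ, ∫⁻ x, K y x ^ r * w x ^ p' ∂μ ≤ M₁ * w y ^ p')
    (h₂ : ∀ᵐ x ∂μ, ∫⁻ y, K y x ^ r * w y ^ q ∂μ ≤ M₂ * w x ^ q) :
    ∫⁻ y, (∫⁻ x, K y x * f x ∂μ) ^ q ∂μ ≤
      M₁ ^ (q / p') * M₂ * (∫⁻ x, f x ^ p ∂μ) ^ (q / p) := by
  have hq : 0 < q := hp.trans_le hpq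
  have hKy : ∀ y, Measurable (K y) := fun y => hK.of_uncurry_left
  set N := ∫⁻ x, f x ^ p ∂μ with hN
  have e3 : 0 ≤ 1 / p - 1 / q := by
    rw [sub_nonneg]; exact one_div_le_one_div_of_le hp hpq
  -- the pointwise three-factor Hölder inequality
  have hold : ∀ y, ∫⁻ x, K y x * f x ∂μ ≤
      (∫⁻ x, K y x ^ r * f x ^ p * w x ^ (-q) ∂μ) ^ (1 / q) *
        (∫⁻ x, K y x ^ r * w x ^ p' ∂μ) ^ (1 / p') * N ^ (1 / p - 1 / q) := by
    intro y
    have hH := ENNReal.lintegral_prod_norm_pow_le (μ := μ) (Finset.univ : Finset (Fin 3))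
      (f := ![fun x => K y x ^ r * f x ^ p * w x ^ (-q), fun x => K y x ^ r * w x ^ p',
        fun x => f x ^ p]) (p := ![1 / q, 1 / p', 1 / p - 1 / q]) ?_ ?_ ?_
    · simp only [Fin.prod_univ_three, Matrix.cons_val_zero, Matrix.cons_val_one,
        Matrix.cons_val_two, Matrix.tail_cons, Matrix.head_cons] at hH
      refine le_trans (lintegral_mono_ae ?_) hH
      filter_upwards [hw0] with x hx
      have hxt := hwtop x
      rcases eq_or_ne (K y x) 0 with hk0 | hk0
      · simp [hk0]
      rcases eq_or_ne (f x) 0 with hf0 | hf0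
      · simp [hf0]
      have hkt := hKtop y x
      have hft := hftop x
      apply le_of_eq
      rw [ENNReal.mul_rpow_of_nonneg _ _ (by positivity), ENNReal.mul_rpow_of_nonneg _ _ (by positivity),
        ENNReal.mul_rpow_of_nonneg _ _ (by positivity)]
      simp only [← ENNReal.rpow_mul]
      have ek : K y x = K y x ^ (r * (1 / q)) * K y x ^ (r * (1 / p')) := by
        rw [← ENNReal.rpow_add _ _ hk0 hkt, ← mul_add, ← hrr, mul_one_div_cancel hr.ne',
          ENNReal.rpow_one]
      have ef : f x = f x ^ (p * (1 / q)) * f x ^ (p * (1 / p - 1 / q)) := by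
        rw [← ENNReal.rpow_add _ _ hf0 hft, ← mul_add, add_sub_cancel, mul_one_div_cancel hp.ne',
          ENNReal.rpow_one]
      have ew : w x ^ (-q * (1 / q)) * w x ^ (p' * (1 / p')) = 1 := by
        rw [← ENNReal.rpow_add _ _ hx hxt, neg_mul, mul_one_div_cancel hq.ne',
          mul_one_div_cancel hp'.ne', neg_add_cancel, ENNReal.rpow_zero]
      calc K y x * f x
          = (K y x ^ (r * (1 / q)) * K y x ^ (r * (1 / p'))) *
            (f x ^ (p * (1 / q)) * f x ^ (p * (1 / p - 1 / q))) *
            (w x ^ (-q * (1 / q)) * w x ^ (p' * (1 / p'))) := by rw [← ek, ← ef, ew, mul_one]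
        _ = _ := by ring
    · intro i _
      have := hKy y
      fin_cases i <;> simp <;> fun_prop
    · simp only [Fin.sum_univ_three, Matrix.cons_val_zero, Matrix.cons_val_one,
        Matrix.cons_val_two, Matrix.tail_cons, Matrix.head_cons]
      linarith
    · intro i _
      fin_cases i
      · exact (by positivity : 0 ≤ 1 / q)
      · exact (by positivity : 0 ≤ 1 / p')
      · exact e3
  have hpow : ∀ᵐ y ∂μ, (∫⁻ x, K y x * f x ∂μ) ^ q ≤
      M₁ ^ (q / p') * N ^ (q / p - 1) *
        ∫⁻ x, K y x ^ r * f x ^ p * w x ^ (-q) * w y ^ q ∂μ := by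
    filter_upwards [h₁] with y hy
    have hm : Measurable fun x => K y x ^ r * f x ^ p * w x ^ (-q) := by
      have := hKy y
      fun_prop
    calc (∫⁻ x, K y x * f x ∂μ) ^ q
        ≤ ((∫⁻ x, K y x ^ r * f x ^ p * w x ^ (-q) ∂μ) ^ (1 / q) *
          (M₁ * w y ^ p') ^ (1 / p') * N ^ (1 / p - 1 / q)) ^ q := by
          refine ENNReal.rpow_le_rpow ((hold y).trans ?_) hq.le
          gcongr
      _ = _ := by
          rw [ENNReal.mul_rpow_of_nonneg _ _ hq.le, ENNReal.mul_rpow_of_nonneg _ _ hq.le,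
            ENNReal.mul_rpow_of_nonneg _ _ (by positivity), ENNReal.mul_rpow_of_nonneg _ _ hq.le]
          simp only [← ENNReal.rpow_mul]
          rw [one_div_mul_cancel hq.ne', mul_one_div_cancel hp'.ne', one_mul, ENNReal.rpow_one,
            sub_mul, one_div_mul_cancel hq.ne', one_div_mul_eq_div, one_div_mul_eq_div,
            lintegral_mul_const _ hm]
          ring
  have hKT : Measurable (Function.uncurry fun x y => K y x) := hK.comp measurable_swap
  calc ∫⁻ y, (∫⁻ x, K y x * f x ∂μ) ^ q ∂μ
      ≤ ∫⁻ y, M₁ ^ (q / p') * N ^ (q / p - 1) *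
        ∫⁻ x, K y x ^ r * f x ^ p * w x ^ (-q) * w y ^ q ∂μ ∂μ := lintegral_mono_ae hpow
    _ = M₁ ^ (q / p') * N ^ (q / p - 1) *
        ∫⁻ y, ∫⁻ x, K y x ^ r * f x ^ p * w x ^ (-q) * w y ^ q ∂μ ∂μ := by
        refine lintegral_const_mul _ (Measurable.lintegral_prod_right ?_)
        simp only [Function.uncurry_def] at hK ⊢
        fun_prop
    _ = M₁ ^ (q / p') * N ^ (q / p - 1) *
        ∫⁻ x, f x ^ p * w x ^ (-q) * ∫⁻ y, K y x ^ r * w y ^ q ∂μ ∂μ := by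
        congr 1
        rw [lintegral_lintegral_swap]
        · congr 1 with x
          rw [← lintegral_const_mul]
          · congr 1 with y
            ring
          · have : Measurable fun y => K y x := hKT.of_uncurry_left (x := x)
            fun_prop
        · simp only [Function.uncurry_def] at hK ⊢
          fun_prop
    _ ≤ M₁ ^ (q / p') * N ^ (q / p - 1) * ∫⁻ x, M₂ * f x ^ p ∂μ := by
        gcongr 1
        refine lintegral_mono_ae ?_
        filter_upwards [h₂, hw0] with x hx hx0
        calc f x ^ p * w x ^ (-q) * ∫⁻ y, K y x ^ r * w y ^ q ∂μ
            ≤ f x ^ p * w x ^ (-q) * (M₂ * w x ^ q) := by gcongr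
          _ = M₂ * f x ^ p * (w x ^ (-q) * w x ^ q) := by ring
          _ = M₂ * f x ^ p := by
            rw [← ENNReal.rpow_add _ _ hx0 (hwtop x), neg_add_cancel, ENNReal.rpow_zero, mul_one]
    _ = M₁ ^ (q / p') * M₂ * (N ^ (q / p - 1) * N ^ (1 : ℝ)) := by
        rw [lintegral_const_mul _ (by fun_prop), ENNReal.rpow_one]
        ring
    _ = M₁ ^ (q / p') * M₂ * N ^ (q / p) := by
        rw [← ENNReal.rpow_add_of_nonneg _ _ _ zero_le_one, sub_add_cancel]
        rw [sub_nonneg, le_div_iff₀ hp, one_mul]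
        exact hpq

/-- If `∫_s G ≤ D (∫_s G)^(1/p)` whenever the left side is finite, then `G` has finite integral. -/
theorem lintegral_ofReal_lt_top_of_forall_le_rpow {X : Type*} [MeasurableSpace X] (μ : Measure X)
    [SigmaFinite μ] (G : X → ℝ) {p : ℝ} (hp : 1 < p) {D : ℝ≥0∞} (hD : D ≠ ⊤)
    (h : ∀ s, MeasurableSet s → ∫⁻ x in s, ENNReal.ofReal (G x) ∂μ < ⊤ →
      ∫⁻ x in s, ENNReal.ofReal (G x) ∂μ ≤ D * (∫⁻ x in s, ENNReal.ofReal (G x) ∂μ) ^ (1 / p)) :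
    ∫⁻ x, ENNReal.ofReal (G x) ∂μ < ⊤ := by
  set m := μ.withDensity fun x => ENNReal.ofReal (G x) with hm
  have hbound : ∀ s, MeasurableSet s → m s < ⊤ → m s ≤ D ^ (1 - 1 / p)⁻¹ := by
    intro s hs hfin
    have hms : m s = ∫⁻ x in s, ENNReal.ofReal (G x) ∂μ := withDensity_apply _ hs
    have h' := h s hs (hms ▸ hfin)
    rw [← hms] at h'
    rcases eq_or_ne (m s) 0 with h0 | h0
    · rw [h0]; exact zero_le
    have hp1 : 0 < 1 - 1 / p := by
      rw [sub_pos, div_lt_one (by linarith)]; exact hp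
    rw [ENNReal.le_rpow_inv_iff hp1, sub_eq_add_neg, ENNReal.rpow_add _ _ h0 hfin.ne,
      ENNReal.rpow_one, ENNReal.rpow_neg]
    refine ENNReal.mul_le_of_le_div ?_
    rw [div_eq_mul_inv, inv_inv]
    exact h'
  have hall : m Set.univ ≤ D ^ (1 - 1 / p)⁻¹ := by
    rw [← Measure.iSup_restrict_spanningSets (μ := m) Set.univ]
    refine iSup_le fun i => ?_
    rw [Measure.restrict_apply MeasurableSet.univ, Set.univ_inter]
    exact hbound _ (measurableSet_spanningSets m i) (measure_spanningSets_lt_top m i)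
  have hu : m Set.univ = ∫⁻ x, ENNReal.ofReal (G x) ∂μ := by
    rw [hm, withDensity_apply _ MeasurableSet.univ, Measure.restrict_univ]
  rw [← hu]
  refine hall.trans_lt (ENNReal.rpow_lt_top_of_nonneg ?_ hD)
  rw [inv_nonneg, sub_nonneg, div_le_one (by linarith)]
  exact hp.le

/-- The linear change of variables `x ↦ (x₁ + x₂, (x₃, …, x_n), x₁ - x₂)`. -/
def lightCone (k : ℕ) : (Fin (k + 2) → ℝ) ≃ₗ[ℝ] ℝ × (Fin k → ℝ) × ℝ where
  toFun x := (x 0 + x 1, fun i => x i.succ.succ, x 0 - x 1)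
  invFun t := Fin.cons ((t.1 + t.2.2) / 2) (Fin.cons ((t.1 - t.2.2) / 2) t.2.1)
  map_add' x y := by
    ext <;> simp <;> ring
  map_smul' c x := by
    ext <;> simp <;> ring
  left_inv x := by
    funext i
    refine Fin.cases ?_ (fun i => ?_) i
    · simp
    · refine Fin.cases ?_ (fun i => ?_) i
      · simp
      · simp
  right_inv t := by
    ext
    · simp; ring
    · simp
    · simp; ring

/-- The parametrization of the cone by `u, s > 0` and `z`, in which `Δ = u s`. -/
def conePoint (k : ℕ) (u s : ℝ) (z : Fin k → ℝ) : Fin (k + 2) → ℝ :=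
  (lightCone k).symm (u, z, s + (∑ i, z i ^ 2) / u)

theorem lightCone_apply (k : ℕ) (x : Fin (k + 2) → ℝ) :
    lightCone k x = (x 0 + x 1, fun i => x i.succ.succ, x 0 - x 1) := rfl

theorem lDelta_eq_lightCone (k : ℕ) (x : Fin (k + 2) → ℝ) :
    lDelta (k + 2) x = (lightCone k x).1 * (lightCone k x).2.2 -
      ∑ i, (lightCone k x).2.1 i ^ 2 := by
  rw [lDelta, Fin.sum_univ_succ, Fin.sum_univ_succ, lightCone_apply]
  simp only [Fin.succ_zero_eq_one]
  ring

theorem mem_lCone_iff_lightCone (k : ℕ) (x : Fin (k + 2) → ℝ) :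
    x ∈ lCone (k + 2) ↔ 0 < (lightCone k x).1 ∧ 0 < lDelta (k + 2) x := by
  have hs : 0 ≤ ∑ i, (lightCone k x).2.1 i ^ 2 := by positivity
  have hd := lDelta_eq_lightCone k x
  rw [lightCone_apply] at *
  simp only at hd hs ⊢
  constructor
  · rintro ⟨h1, h2⟩
    refine ⟨?_, h1⟩
    nlinarith
  · rintro ⟨h1, h2⟩
    refine ⟨h2, ?_⟩
    have : 0 < x 0 - x 1 := by
      by_contra hcon
      nlinarith
    linarith

theorem lDelta_conePoint (k : ℕ) {u : ℝ} (hu : 0 < u) (s : ℝ) (z : Fin k → ℝ) :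
    lDelta (k + 2) (conePoint k u s z) = u * s := by
  rw [lDelta_eq_lightCone, conePoint, LinearEquiv.apply_symm_apply]
  field_simp
  ring

theorem lightCone_conePoint_fst (k : ℕ) (u s : ℝ) (z : Fin k → ℝ) :
    (lightCone k (conePoint k u s z)).1 = u := by
  rw [conePoint, LinearEquiv.apply_symm_apply]

theorem conePoint_mem_lCone (k : ℕ) {u s : ℝ} (hu : 0 < u) (hs : 0 < s) (z : Fin k → ℝ) :
    conePoint k u s z ∈ lCone (k + 2) := by
  rw [mem_lCone_iff_lightCone, lightCone_conePoint_fst, lDelta_conePoint k hu]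
  exact ⟨hu, mul_pos hu hs⟩

theorem exists_eq_conePoint (k : ℕ) {x : Fin (k + 2) → ℝ} (hx : x ∈ lCone (k + 2)) :
    ∃ z, x = conePoint k (lightCone k x).1 (lDelta (k + 2) x / (lightCone k x).1) z := by
  have h := (mem_lCone_iff_lightCone k x).1 hx
  refine ⟨(lightCone k x).2.1, ?_⟩
  rw [conePoint, LinearEquiv.eq_symm_apply, lDelta_eq_lightCone, ← add_div, sub_add_cancel,
    mul_div_cancel_left₀ _ h.1.ne']

theorem lDelta_conePoint_add (k : ℕ) {u u₀ : ℝ} (hu : 0 < u) (hu₀ : 0 < u₀) (s s₀ : ℝ)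
    (z z₀ : Fin k → ℝ) :
    lDelta (k + 2) (conePoint k u₀ s₀ z₀ + conePoint k u s z) =
      (u₀ + u) * (s₀ + s) + u₀ / u * ∑ i, (z i - (u / u₀ * z₀ i)) ^ 2 := by
  rw [lDelta_eq_lightCone, map_add, conePoint, conePoint, LinearEquiv.apply_symm_apply,
    LinearEquiv.apply_symm_apply]
  simp only [Prod.mk_add_mk, Pi.add_apply]
  have h1 : ∑ i, (z₀ i + z i) ^ 2 = ∑ i, z₀ i ^ 2 + 2 * ∑ i, z i * z₀ i + ∑ i, z i ^ 2 := by
    rw [Finset.mul_sum, ← Finset.sum_add_distrib, ← Finset.sum_add_distrib]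
    exact Finset.sum_congr rfl fun i _ => by ring
  have h2 : ∑ i, (z i - (u / u₀ * z₀ i)) ^ 2 =
      ∑ i, z i ^ 2 - 2 * (u / u₀) * ∑ i, z i * z₀ i + (u / u₀) ^ 2 * ∑ i, z₀ i ^ 2 := by
    rw [Finset.mul_sum, Finset.mul_sum, ← Finset.sum_sub_distrib, ← Finset.sum_add_distrib]
    exact Finset.sum_congr rfl fun i _ => by ring
  rw [h1, h2]
  field_simp
  ring

theorem continuous_lDelta (n : ℕ) [NeZero n] : Continuous (lDelta n) := by
  unfold lDelta
  fun_prop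

@[fun_prop]
theorem measurable_lDelta (n : ℕ) [NeZero n] : Measurable (lDelta n) :=
  (continuous_lDelta n).measurable

theorem isOpen_lCone (n : ℕ) [NeZero n] : IsOpen (lCone n) :=
  (isOpen_lt continuous_const (continuous_lDelta n)).inter
    (isOpen_lt continuous_const (continuous_apply 0))

theorem measurableSet_lCone (n : ℕ) [NeZero n] : MeasurableSet (lCone n) :=
  (isOpen_lCone n).measurableSet

theorem continuous_lightCone (k : ℕ) : Continuous (lightCone k) :=
  (lightCone k).toLinearMap.continuous_of_finiteDimensional

theorem exists_lintegral_lCone_eq (k : ℕ) : ∃ c : ℝ≥0∞, c ≠ 0 ∧ c ≠ ⊤ ∧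
    ∀ F : (Fin (k + 2) → ℝ) → ℝ≥0∞, Measurable F → ∫⁻ x in lCone (k + 2), F x =
      c * ∫⁻ u in Set.Ioi (0 : ℝ), ∫⁻ s in Set.Ioi (0 : ℝ), ∫⁻ z, F (conePoint k u s z) := by
  let L := (lightCone k).symm.toContinuousLinearEquiv
  have hL : ∀ t, L t = (lightCone k).symm t := fun t => rfl
  have hLm : Measurable L := L.continuous.measurable
  set m := Measure.map L (volume : Measure (ℝ × (Fin k → ℝ) × ℝ)) with hm
  have : (volume : Measure ((Fin k → ℝ) × ℝ)).IsAddHaarMeasure :=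
    Measure.prod.instIsAddHaarMeasure _ _
  have : (volume : Measure (ℝ × (Fin k → ℝ) × ℝ)).IsAddHaarMeasure :=
    Measure.prod.instIsAddHaarMeasure _ _
  have : m.IsAddHaarMeasure := ContinuousLinearEquiv.isAddHaarMeasure_map L volume
  refine ⟨(volume : Measure (Fin (k + 2) → ℝ)).addHaarScalarFactor m, ?_, ENNReal.coe_ne_top, ?_⟩
  · exact_mod_cast (Measure.addHaarScalarFactor_pos_of_isAddHaarMeasure _ _).ne'
  intro F hF
  have hvol := Measure.isAddLeftInvariant_eq_smul (volume : Measure (Fin (k + 2) → ℝ)) m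
  set G : (Fin (k + 2) → ℝ) → ℝ≥0∞ := (lCone (k + 2)).indicator F with hG
  have hGm : Measurable G := hF.indicator (measurableSet_lCone _)
  rw [← lintegral_indicator (measurableSet_lCone _), ← hG]
  conv_lhs => rw [hvol]
  rw [lintegral_smul_measure, ENNReal.smul_def, smul_eq_mul]
  congr 1
  rw [hm, lintegral_map hGm hLm]
  have hGL : Measurable fun t => G (L t) := hGm.comp hLm
  rw [Measure.volume_eq_prod, lintegral_prod _ hGL.aemeasurable,
    ← lintegral_indicator measurableSet_Ioi]
  congr 1 with u
  have hGu : Measurable fun t => G (L (u, t)) := hGL.comp measurable_prodMk_left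
  rw [Measure.volume_eq_prod, lintegral_prod _ hGu.aemeasurable]
  by_cases hu : 0 < u
  · rw [Set.indicator_of_mem (by simpa using hu), ← lintegral_indicator measurableSet_Ioi]
    have hshift : ∀ z : Fin k → ℝ, ∫⁻ v, G (L (u, z, v)) =
        ∫⁻ s, G (L (u, z, s + (∑ i, z i ^ 2) / u)) := fun z =>
      (lintegral_add_right_eq_self (μ := (volume : Measure ℝ)) (fun v => G (L (u, z, v))) _).symm
    simp_rw [hshift]
    rw [lintegral_lintegral_swap]
    · congr 1 with s
      by_cases hs : 0 < s
      · rw [Set.indicator_of_mem (by simpa using hs)]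
        congr 1 with z
        exact Set.indicator_of_mem (conePoint_mem_lCone k hu hs z) F
      · rw [Set.indicator_of_notMem (by simpa using hs)]
        refine (lintegral_congr fun z => Set.indicator_of_notMem (fun hmem => hs ?_) F).trans
          lintegral_zero
        have h2 : 0 < lDelta (k + 2) (conePoint k u s z) := hmem.1
        rw [lDelta_conePoint k hu] at h2
        exact pos_of_mul_pos_right h2 hu.le
    · refine Measurable.aemeasurable ?_
      rw [Function.uncurry_def]
      refine hGL.comp ?_
      fun_prop
  · rw [Set.indicator_of_notMem (by simpa using hu)]
    refine (lintegral_congr fun z => ?_).trans lintegral_zero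
    refine (lintegral_congr fun v => Set.indicator_of_notMem (fun hmem => hu ?_) F).trans
          lintegral_zero
    have h2 := ((mem_lCone_iff_lightCone k _).1 hmem).1
    rwa [hL, LinearEquiv.apply_symm_apply] at h2

theorem rpow_coordinates_identity {u s u₀ a b : ℝ} (hu : 0 < u) (hs : 0 < s) (hu₀ : 0 < u₀)
    (ha : 0 < a) (hb : 0 < b) (A C κ m : ℝ) :
    (u * s) ^ (A - (m + 1)) * (u * s / u ^ 2) ^ κ * ((a * b) ^ (-C) * (a * b / (u₀ / u)) ^ m) =
      u₀ ^ (-m) * (u ^ (A - κ - 1) * a ^ (-(C - m))) * (s ^ (A + κ - m - 1) * b ^ (-(C - m))) := by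
  rw [show u * s / u ^ 2 = s / u by field_simp, Real.rpow_def_of_pos (mul_pos hu hs),
    Real.rpow_def_of_pos (div_pos hs hu), Real.rpow_def_of_pos (mul_pos ha hb),
    Real.rpow_def_of_pos (by positivity : 0 < a * b / (u₀ / u)), Real.rpow_def_of_pos hu₀,
    Real.rpow_def_of_pos hu, Real.rpow_def_of_pos ha, Real.rpow_def_of_pos hs,
    Real.rpow_def_of_pos hb, Real.log_div (mul_pos ha hb).ne' (div_pos hu₀ hu).ne',
    Real.log_div hs.ne' hu.ne', Real.log_div hu₀.ne' hu.ne', Real.log_mul hu.ne' hs.ne',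
    Real.log_mul ha.ne' hb.ne']
  simp only [← Real.exp_add]
  congr 1
  ring

/-- The basic integral of the kernel against powers of `Δ` and of `s / u = Δ / u²`. -/
theorem exists_lintegral_lDelta_add_eq (k : ℕ) : ∃ c : ℝ≥0∞, c ≠ 0 ∧ c ≠ ⊤ ∧
    ∀ A C κ : ℝ, ∀ y ∈ lCone (k + 2),
      ∫⁻ x in lCone (k + 2), ENNReal.ofReal (lDelta (k + 2) (y + x) ^ (-C) *
        lDelta (k + 2) x ^ (A - ((k : ℝ) / 2 + 1)) *
        (lDelta (k + 2) x / (lightCone k x).1 ^ 2) ^ κ) =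
      c * bracketInt k C * betaInt (A - κ) (C - (k : ℝ) / 2) *
        betaInt (A + κ - (k : ℝ) / 2) (C - (k : ℝ) / 2) *
        ENNReal.ofReal (lDelta (k + 2) y ^ (A - C) *
          (lDelta (k + 2) y / (lightCone k y).1 ^ 2) ^ κ) := by
  obtain ⟨c, hc0, hct, hc⟩ := exists_lintegral_lCone_eq k
  refine ⟨c, hc0, hct, fun A C κ y hy => ?_⟩
  set m : ℝ := (k : ℝ) / 2 with hm
  have hyu := ((mem_lCone_iff_lightCone k y).1 hy).1
  have hyd := ((mem_lCone_iff_lightCone k y).1 hy).2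
  set u₀ := (lightCone k y).1 with hu₀
  set s₀ := lDelta (k + 2) y / u₀ with hs₀
  have hs₀pos : 0 < s₀ := div_pos hyd hyu
  obtain ⟨z₀, hz₀⟩ := exists_eq_conePoint k hy
  have hLm : Measurable fun x => (lightCone k x).1 := (continuous_lightCone k).measurable.fst
  rw [hc _ (by fun_prop)]
  have hDy : lDelta (k + 2) y = u₀ * s₀ := by rw [hs₀]; field_simp
  have hz : ∀ u ∈ Set.Ioi (0 : ℝ), ∀ s ∈ Set.Ioi (0 : ℝ),
      ∫⁻ z, ENNReal.ofReal (lDelta (k + 2) (y + conePoint k u s z) ^ (-C) *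
        lDelta (k + 2) (conePoint k u s z) ^ (A - (m + 1)) *
        (lDelta (k + 2) (conePoint k u s z) / (lightCone k (conePoint k u s z)).1 ^ 2) ^ κ) =
      bracketInt k C * ENNReal.ofReal (u₀ ^ (-m)) *
        ENNReal.ofReal (u ^ (A - κ - 1) * (u₀ + u) ^ (-(C - m))) *
        ENNReal.ofReal (s ^ (A + κ - m - 1) * (s₀ + s) ^ (-(C - m))) := by
    intro u hu s hs
    have hu' : 0 < u := hu
    have hs' : 0 < s := hs
    have e1 : ∀ z, lDelta (k + 2) (y + conePoint k u s z) =
        (u₀ + u) * (s₀ + s) + u₀ / u * ∑ i, (z i - (u / u₀ * z₀ i)) ^ 2 := by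
      intro z
      conv_lhs => rw [hz₀]
      exact lDelta_conePoint_add k hu hyu s s₀ z z₀
    simp_rw [e1, lDelta_conePoint k hu', lightCone_conePoint_fst]
    have e2 : ∀ z : Fin k → ℝ, ENNReal.ofReal
        (((u₀ + u) * (s₀ + s) + u₀ / u * ∑ i, (z i - (u / u₀ * z₀ i)) ^ 2) ^ (-C) *
        (u * s) ^ (A - (m + 1)) * (u * s / u ^ 2) ^ κ) =
        ENNReal.ofReal ((u * s) ^ (A - (m + 1)) * (u * s / u ^ 2) ^ κ) * ENNReal.ofReal
        (((u₀ + u) * (s₀ + s) + u₀ / u * ∑ i, (z i - (u / u₀ * z₀ i)) ^ 2) ^ (-C)) := by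
      intro z
      rw [← ENNReal.ofReal_mul (by positivity)]
      congr 1
      ring
    simp_rw [e2]
    rw [lintegral_const_mul _ (by fun_prop), lintegral_add_mul_sum_sq_rpow k C (by positivity)
      (by positivity) (fun i => u / u₀ * z₀ i)]
    have e3 := rpow_coordinates_identity hu' hs' hyu (by positivity : 0 < u₀ + u)
      (by positivity : 0 < s₀ + s) A C κ m
    calc _ = bracketInt k C * (ENNReal.ofReal ((u * s) ^ (A - (m + 1)) * (u * s / u ^ 2) ^ κ) *
          ENNReal.ofReal (((u₀ + u) * (s₀ + s)) ^ (-C) *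
            ((u₀ + u) * (s₀ + s) / (u₀ / u)) ^ m)) := by ring
      _ = bracketInt k C * (ENNReal.ofReal (u₀ ^ (-m)) *
          ENNReal.ofReal (u ^ (A - κ - 1) * (u₀ + u) ^ (-(C - m))) *
          ENNReal.ofReal (s ^ (A + κ - m - 1) * (s₀ + s) ^ (-(C - m)))) := by
        rw [← ENNReal.ofReal_mul (by positivity), ← ENNReal.ofReal_mul (by positivity),
          ← ENNReal.ofReal_mul (by positivity), e3]
      _ = _ := by ring
  have hsI : ∀ u ∈ Set.Ioi (0 : ℝ), ∫⁻ s in Set.Ioi (0 : ℝ), ∫⁻ z,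
      ENNReal.ofReal (lDelta (k + 2) (y + conePoint k u s z) ^ (-C) *
        lDelta (k + 2) (conePoint k u s z) ^ (A - (m + 1)) *
        (lDelta (k + 2) (conePoint k u s z) / (lightCone k (conePoint k u s z)).1 ^ 2) ^ κ) =
      bracketInt k C * ENNReal.ofReal (u₀ ^ (-m)) *
        (ENNReal.ofReal (s₀ ^ (A + κ - m - (C - m))) * betaInt (A + κ - m) (C - m)) *
        ENNReal.ofReal (u ^ (A - κ - 1) * (u₀ + u) ^ (-(C - m))) := by
    intro u hu
    rw [setLIntegral_congr_fun measurableSet_Ioi (hz u hu), lintegral_const_mul _ (by fun_prop),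
      setLIntegral_Ioi_rpow_mul_add_rpow _ _ hs₀pos]
    ring
  rw [setLIntegral_congr_fun measurableSet_Ioi hsI, lintegral_const_mul _ (by fun_prop),
    setLIntegral_Ioi_rpow_mul_add_rpow _ _ hyu]
  have e4 : u₀ ^ (-m) * s₀ ^ (A + κ - m - (C - m)) * u₀ ^ (A - κ - (C - m)) =
      lDelta (k + 2) y ^ (A - C) * (lDelta (k + 2) y / u₀ ^ 2) ^ κ := by
    rw [hDy, Real.mul_rpow hyu.le hs₀pos.le, show u₀ * s₀ / u₀ ^ 2 = s₀ / u₀ by field_simp,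
      Real.div_rpow hs₀pos.le hyu.le, div_eq_mul_inv, ← Real.rpow_neg hyu.le,
      show A + κ - m - (C - m) = (A - C) + κ by ring, Real.rpow_add hs₀pos,
      show A - κ - (C - m) = m + (A - C) + -κ by ring, Real.rpow_add hyu, Real.rpow_add hyu,
      Real.rpow_neg hyu.le m]
    have : u₀ ^ m ≠ 0 := by positivity
    field_simp
  rw [← e4, ENNReal.ofReal_mul (by positivity), ENNReal.ofReal_mul (by positivity)]
  ring

@[fun_prop]
theorem measurable_lightCone_fst (k : ℕ) :
    Measurable fun x : Fin (k + 2) → ℝ => (lightCone k x).1 :=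
  (continuous_lightCone k).measurable.fst

theorem lDelta_le_lDelta_add (k : ℕ) {x y : Fin (k + 2) → ℝ} (hx : x ∈ lCone (k + 2))
    (hy : y ∈ lCone (k + 2)) : lDelta (k + 2) x ≤ lDelta (k + 2) (x + y) := by
  have hxu := (mem_lCone_iff_lightCone k x).1 hx
  have hyu := (mem_lCone_iff_lightCone k y).1 hy
  obtain ⟨z, hz⟩ := exists_eq_conePoint k hx
  obtain ⟨w, hw⟩ := exists_eq_conePoint k hy
  have hsx := div_pos hxu.2 hxu.1
  have hsy := div_pos hyu.2 hyu.1
  have h1 : lDelta (k + 2) x =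
      (lightCone k x).1 * (lDelta (k + 2) x / (lightCone k x).1) := by
    have := hxu.1.ne'
    field_simp
  have h2 := lDelta_conePoint_add k hyu.1 hxu.1 (lDelta (k + 2) y / (lightCone k y).1)
    (lDelta (k + 2) x / (lightCone k x).1) w z
  rw [← hz, ← hw] at h2
  rw [h2, h1]
  have h3 : 0 ≤ (lightCone k x).1 / (lightCone k y).1 *
      ∑ i, (w i - (lightCone k y).1 / (lightCone k x).1 * z i) ^ 2 :=
    mul_nonneg (div_pos hxu.1 hyu.1).le (by positivity)
  rw [← h1]
  have := mul_pos hxu.1 hsy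
  have := mul_pos hyu.1 hsx
  have := mul_pos hyu.1 hsy
  nlinarith

theorem add_mem_lCone (k : ℕ) {x y : Fin (k + 2) → ℝ} (hx : x ∈ lCone (k + 2))
    (hy : y ∈ lCone (k + 2)) : x + y ∈ lCone (k + 2) :=
  ⟨hx.1.trans_le (lDelta_le_lDelta_add k hx hy), add_pos hx.2 hy.2⟩

theorem lDelta_smul (n : ℕ) [NeZero n] (t : ℝ) (x : Fin n → ℝ) :
    lDelta n (t • x) = t ^ 2 * lDelta n x := by
  simp only [lDelta, Pi.smul_apply, smul_eq_mul, mul_pow]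
  rw [← Finset.mul_sum]
  ring

theorem smul_mem_lCone_iff (n : ℕ) [NeZero n] {t : ℝ} (ht : 0 < t) (x : Fin n → ℝ) :
    t • x ∈ lCone n ↔ x ∈ lCone n := by
  simp only [lCone, Set.mem_ofPred_eq, lDelta_smul, Pi.smul_apply, smul_eq_mul]
  rw [mul_pos_iff_of_pos_left ht, mul_pos_iff_of_pos_left (by positivity)]

/-- The invariant measure `Δ(x)^(-n/2) dx` of the cone. -/
def coneMeasure (k : ℕ) : Measure (Fin (k + 2) → ℝ) :=
  (volume.restrict (lCone (k + 2))).withDensity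
    fun x => ENNReal.ofReal (lDelta (k + 2) x ^ (-((k : ℝ) / 2 + 1)))

theorem lintegral_coneMeasure (k : ℕ) {F : (Fin (k + 2) → ℝ) → ℝ≥0∞} (hF : Measurable F) :
    ∫⁻ x, F x ∂coneMeasure k =
      ∫⁻ x in lCone (k + 2), ENNReal.ofReal (lDelta (k + 2) x ^ (-((k : ℝ) / 2 + 1))) * F x :=
  lintegral_withDensity_eq_lintegral_mul _ (by fun_prop) hF

theorem ae_coneMeasure_mem (k : ℕ) : ∀ᵐ x ∂coneMeasure k, x ∈ lCone (k + 2) :=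
  (withDensity_absolutelyContinuous _ _).ae_le (ae_restrict_mem (measurableSet_lCone _))

instance sFinite_coneMeasure (k : ℕ) : SFinite (coneMeasure k) := by
  unfold coneMeasure
  infer_instance

theorem exists_lintegral_kernel_weight_le (k : ℕ) {a b r θ e : ℝ} (hr : 0 < r) (he : 0 < e)
    (h1 : θ * e < r * b) (h2 : (k : ℝ) / 2 < r * a + θ * e)
    (h3 : (k : ℝ) / 2 < r * b + θ * e) (h4 : θ * e < r * a) :
    ∃ M : ℝ≥0∞, M ≠ ⊤ ∧ ∀ y ∈ lCone (k + 2), ∫⁻ x, ENNReal.ofReal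
        (lDelta (k + 2) (y + x) ^ (-(a + b)) * lDelta (k + 2) x ^ b * lDelta (k + 2) y ^ a) ^ r *
        ENNReal.ofReal ((lDelta (k + 2) x / (lightCone k x).1 ^ 2) ^ θ) ^ e ∂coneMeasure k ≤
      M * ENNReal.ofReal ((lDelta (k + 2) y / (lightCone k y).1 ^ 2) ^ θ) ^ e := by
  obtain ⟨c, -, hct, hc⟩ := exists_lintegral_lDelta_add_eq k
  refine ⟨c * bracketInt k (r * (a + b)) * betaInt (r * b - θ * e) (r * (a + b) - (k : ℝ) / 2) *
    betaInt (r * b + θ * e - (k : ℝ) / 2) (r * (a + b) - (k : ℝ) / 2), ?_, fun y hy => ?_⟩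
  · refine ENNReal.mul_ne_top (ENNReal.mul_ne_top (ENNReal.mul_ne_top hct
      (bracketInt_lt_top k ?_).ne) ((betaInt_lt_top_iff _ _).2 ⟨?_, ?_⟩).ne)
      ((betaInt_lt_top_iff _ _).2 ⟨?_, ?_⟩).ne <;> linarith
  have hyu := (mem_lCone_iff_lightCone k y).1 hy
  rw [lintegral_coneMeasure k (by fun_prop)]
  have hcongr : ∀ x ∈ lCone (k + 2),
      ENNReal.ofReal (lDelta (k + 2) x ^ (-((k : ℝ) / 2 + 1))) * (ENNReal.ofReal
        (lDelta (k + 2) (y + x) ^ (-(a + b)) * lDelta (k + 2) x ^ b * lDelta (k + 2) y ^ a) ^ r *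
        ENNReal.ofReal ((lDelta (k + 2) x / (lightCone k x).1 ^ 2) ^ θ) ^ e) =
      ENNReal.ofReal (lDelta (k + 2) y ^ (r * a)) * ENNReal.ofReal
        (lDelta (k + 2) (y + x) ^ (-(r * (a + b))) *
        lDelta (k + 2) x ^ (r * b - ((k : ℝ) / 2 + 1)) *
        (lDelta (k + 2) x / (lightCone k x).1 ^ 2) ^ (θ * e)) := by
    intro x hx
    have hxu := (mem_lCone_iff_lightCone k x).1 hx
    have hxy := (add_mem_lCone k hy hx).1
    obtain ⟨hx1, hx2⟩ := hxu
    have hy2 := hyu.2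
    rw [ENNReal.ofReal_rpow_of_nonneg (by positivity) hr.le,
      ENNReal.ofReal_rpow_of_nonneg (by positivity) he.le, ← ENNReal.ofReal_mul (by positivity),
      ← ENNReal.ofReal_mul (by positivity), ← ENNReal.ofReal_mul (by positivity)]
    congr 1
    rw [Real.mul_rpow (by positivity) (by positivity), Real.mul_rpow (by positivity) (by positivity),
      ← Real.rpow_mul hxy.le, ← Real.rpow_mul hx2.le, ← Real.rpow_mul hy2.le,
      ← Real.rpow_mul (by positivity), sub_eq_add_neg (r * b), Real.rpow_add hx2,
      mul_comm a r, mul_comm b r, neg_mul, mul_comm (a + b) r]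
    ring
  rw [setLIntegral_congr_fun (measurableSet_lCone _) hcongr, lintegral_const_mul _ (by fun_prop),
    hc _ _ _ y hy]
  obtain ⟨hy1, hy2⟩ := hyu
  apply le_of_eq
  rw [ENNReal.ofReal_rpow_of_nonneg (by positivity) he.le, ← Real.rpow_mul (by positivity),
    mul_left_comm, ← ENNReal.ofReal_mul (by positivity)]
  congr 2
  rw [← mul_assoc, ← Real.rpow_add hy2, show r * a + (r * b - r * (a + b)) = 0 by ring,
    Real.rpow_zero, one_mul]

theorem sBounded_of_lt (k : ℕ) {α β γ ν μ p p' q : ℝ} (hp : 0 < p) (hp' : 0 < p')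
    (hpp' : 1 / p + 1 / p' = 1) (hpq : p ≤ q)
    (hγ : γ = α + β + ((k : ℝ) / 2 + 1) - ν / p + μ / q)
    (haq : (k : ℝ) / 2 / q < α + μ / q) (hap : (k : ℝ) / 2 / p' < α + μ / q)
    (hbq : (k : ℝ) / 2 / q < β + ((k : ℝ) / 2 + 1) - ν / p)
    (hbp : (k : ℝ) / 2 / p' < β + ((k : ℝ) / 2 + 1) - ν / p) :
    SBounded (k + 2) α β γ p ν q μ := by
  have hq : 0 < q := hp.trans_le hpq
  set m : ℝ := (k : ℝ) / 2 with hm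
  have hn : ((k + 2 : ℕ) : ℝ) / 2 = m + 1 := by push_cast; rw [hm]; ring
  set a := α + μ / q with ha
  set b := β + (m + 1) - ν / p with hb
  have hγab : γ = a + b := by rw [hγ, ha, hb]; ring
  have hrpos : 0 < 1 / q + 1 / p' := by positivity
  obtain ⟨r, hr⟩ : ∃ r : ℝ, r = (1 / q + 1 / p')⁻¹ := ⟨_, rfl⟩
  have hr0 : 0 < r := by rw [hr]; positivity
  have hrr : 1 / r = 1 / q + 1 / p' := by rw [hr, one_div, inv_inv]
  have hrs : r * (m / q) + r * (m / p') = m := by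
    have : r * (1 / q + 1 / p') = 1 := by rw [← hrr]; field_simp
    calc _ = m * (r * (1 / q + 1 / p')) := by ring
      _ = m := by rw [this, mul_one]
  obtain ⟨θ, hθ⟩ : ∃ θ : ℝ, θ = r * m / (q * p') := ⟨_, rfl⟩
  have hθp : θ * p' = r * (m / q) := by rw [hθ]; field_simp
  have hθq : θ * q = r * (m / p') := by rw [hθ]; field_simp
  have kaq := mul_lt_mul_of_pos_left haq hr0
  have kap := mul_lt_mul_of_pos_left hap hr0
  have kbq := mul_lt_mul_of_pos_left hbq hr0
  have kbp := mul_lt_mul_of_pos_left hbp hr0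
  obtain ⟨M₁, hM₁, h₁⟩ := exists_lintegral_kernel_weight_le k (a := a) (b := b) (r := r) (θ := θ)
    (e := p') hr0 hp' (by linarith) (by linarith) (by linarith) (by linarith)
  obtain ⟨M₂, hM₂, h₂⟩ := exists_lintegral_kernel_weight_le k (a := b) (b := a) (r := r) (θ := θ)
    (e := q) hr0 hq (by linarith) (by linarith) (by linarith) (by linarith)
  set T : ℝ≥0∞ := (M₁ ^ (q / p') * M₂) ^ (1 / q) with hT
  have hTt : T ≠ ⊤ := by
    refine ENNReal.rpow_ne_top_of_nonneg (by positivity) (ENNReal.mul_ne_top ?_ hM₂)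
    exact ENNReal.rpow_ne_top_of_nonneg (by positivity) hM₁
  refine ⟨T.toReal + 1, by positivity, fun g hg _ => ?_⟩
  set K : (Fin (k + 2) → ℝ) → (Fin (k + 2) → ℝ) → ℝ≥0∞ := fun y x => ENNReal.ofReal
    (lDelta (k + 2) (y + x) ^ (-(a + b)) * lDelta (k + 2) x ^ b * lDelta (k + 2) y ^ a) with hK
  set f : (Fin (k + 2) → ℝ) → ℝ≥0∞ := fun x =>
    ENNReal.ofReal (|g x| * lDelta (k + 2) x ^ (ν / p)) with hf
  have hfm : Measurable f := by fun_prop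
  have hKm : Measurable (Function.uncurry K) := by
    rw [Function.uncurry_def]
    fun_prop
  have hKym : ∀ y, Measurable (K y) := fun y => hKm.of_uncurry_left
  have main := lintegral_kernel_rpow_le (coneMeasure k) hKm
    (w := fun x => ENNReal.ofReal ((lDelta (k + 2) x / (lightCone k x).1 ^ 2) ^ θ)) (f := f)
    (by fun_prop) hfm (fun _ _ => ENNReal.ofReal_ne_top) (fun _ => ENNReal.ofReal_ne_top)
    (by
      filter_upwards [ae_coneMeasure_mem k] with x hx
      obtain ⟨hx1, hx2⟩ := (mem_lCone_iff_lightCone k x).1 hx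
      rw [ne_eq, ENNReal.ofReal_eq_zero, not_le]
      positivity)
    (fun _ => ENNReal.ofReal_ne_top) hp hp' hpp' hpq hr0 hrr (M₁ := M₁) (M₂ := M₂)
    (by filter_upwards [ae_coneMeasure_mem k] with y hy using h₁ y hy)
    (by
      filter_upwards [ae_coneMeasure_mem k] with x hx
      refine le_trans (le_of_eq (lintegral_congr fun y => ?_)) (h₂ x hx)
      rw [hK]
      simp only
      rw [add_comm y x, add_comm a b, mul_right_comm])
  have hnorm : coneNorm (k + 2) p ν g = (∫⁻ x, f x ^ p ∂coneMeasure k) ^ (1 / p) := by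
    rw [coneNorm, lintegral_coneMeasure k (by fun_prop)]
    congr 1
    refine setLIntegral_congr_fun (measurableSet_lCone _) fun x hx => ?_
    have hx2 : 0 < lDelta (k + 2) x := hx.1
    simp only [hf]
    rw [ENNReal.ofReal_rpow_of_nonneg (by positivity) hp.le, ← ENNReal.ofReal_mul (by positivity)]
    congr 1
    rw [Real.mul_rpow (abs_nonneg _) (by positivity), ← Real.rpow_mul hx2.le,
      div_mul_cancel₀ _ hp.ne', hn, sub_eq_add_neg, Real.rpow_add hx2]
    ring
  have hSop : ∀ y ∈ lCone (k + 2), ∫⁻ x, K y x * f x ∂coneMeasure k =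
      ENNReal.ofReal (lDelta (k + 2) y ^ (μ / q)) * Sop (k + 2) α β γ g y := by
    intro y hy
    have hy2 : 0 < lDelta (k + 2) y := hy.1
    have := hKym y
    rw [Sop, ← mul_assoc, ← ENNReal.ofReal_mul (by positivity), ← lintegral_const_mul _
      (by fun_prop), lintegral_coneMeasure k (by fun_prop)]
    refine setLIntegral_congr_fun (measurableSet_lCone _) fun x hx => ?_
    have hx2 : 0 < lDelta (k + 2) x := hx.1
    have hxy := (add_mem_lCone k hy hx).1
    simp only [hf, hK]
    rw [← ENNReal.ofReal_mul (by positivity), ← ENNReal.ofReal_mul (by positivity),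
      ← ENNReal.ofReal_mul (by positivity)]
    congr 1
    rw [hγab, show β = -(m + 1) + b + ν / p by rw [hb]; ring, Real.rpow_add hx2, Real.rpow_add hx2,
      ← Real.rpow_add hy2 (μ / q), show μ / q + α = a by rw [ha]; ring]
    ring
  have hSnorm : SopNorm (k + 2) α β γ q μ g =
      (∫⁻ y, (∫⁻ x, K y x * f x ∂coneMeasure k) ^ q ∂coneMeasure k) ^ (1 / q) := by
    have hmeas : Measurable fun y => (∫⁻ x, K y x * f x ∂coneMeasure k) ^ q := by
      refine Measurable.pow_const (Measurable.lintegral_prod_right ?_) q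
      simp only [Function.uncurry_def] at hKm ⊢
      fun_prop
    rw [SopNorm, lintegral_coneMeasure k hmeas]
    congr 1
    refine setLIntegral_congr_fun (measurableSet_lCone _) fun y hy => ?_
    have hy2 : 0 < lDelta (k + 2) y := hy.1
    rw [hSop y hy, ENNReal.mul_rpow_of_nonneg _ _ hq.le,
      ENNReal.ofReal_rpow_of_nonneg (by positivity) hq.le, ← mul_assoc,
      ← ENNReal.ofReal_mul (by positivity), mul_comm]
    congr 2
    rw [← Real.rpow_mul hy2.le, div_mul_cancel₀ _ hq.ne', hn, sub_eq_add_neg, add_comm μ,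
      Real.rpow_add hy2]
  rw [hSnorm, hnorm]
  calc _ ≤ (M₁ ^ (q / p') * M₂ * (∫⁻ x, f x ^ p ∂coneMeasure k) ^ (q / p)) ^ (1 / q) :=
        ENNReal.rpow_le_rpow main (by positivity)
    _ = T * (∫⁻ x, f x ^ p ∂coneMeasure k) ^ (1 / p) := by
        rw [ENNReal.mul_rpow_of_nonneg _ _ (by positivity), ← ENNReal.rpow_mul]
        congr 2
        field_simp
    _ ≤ _ := by
        gcongr
        rw [← ENNReal.ofReal_toReal hTt]
        exact ENNReal.ofReal_le_ofReal (by simp)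

/-- The identity element `e = (1, 0, …, 0)` of the cone. -/
def coneUnit (k : ℕ) : Fin (k + 2) → ℝ := Pi.single 0 1

theorem lightCone_coneUnit_fst (k : ℕ) : (lightCone k (coneUnit k)).1 = 1 := by
  simp [lightCone_apply, coneUnit]

theorem lDelta_coneUnit (k : ℕ) : lDelta (k + 2) (coneUnit k) = 1 := by
  rw [lDelta_eq_lightCone]
  simp [lightCone_apply, coneUnit]

theorem coneUnit_mem (k : ℕ) : coneUnit k ∈ lCone (k + 2) := by
  rw [mem_lCone_iff_lightCone, lightCone_coneUnit_fst, lDelta_coneUnit]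
  simp

theorem exists_lintegral_coneUnit_eq (k : ℕ) : ∃ c : ℝ≥0∞, c ≠ 0 ∧
    ∀ A C : ℝ, ∫⁻ x in lCone (k + 2), ENNReal.ofReal (lDelta (k + 2) (coneUnit k + x) ^ (-C) *
        lDelta (k + 2) x ^ (A - ((k : ℝ) / 2 + 1))) =
      c * bracketInt k C * betaInt A (C - (k : ℝ) / 2) *
        betaInt (A - (k : ℝ) / 2) (C - (k : ℝ) / 2) := by
  obtain ⟨c, hc0, -, hc⟩ := exists_lintegral_lDelta_add_eq k
  refine ⟨c, hc0, fun A C => ?_⟩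
  have := hc A C 0 _ (coneUnit_mem k)
  simpa [lDelta_coneUnit, lightCone_coneUnit_fst] using this

theorem lintegral_coneUnit_ne_zero (k : ℕ) (A C : ℝ) :
    ∫⁻ x in lCone (k + 2), ENNReal.ofReal (lDelta (k + 2) (coneUnit k + x) ^ (-C) *
        lDelta (k + 2) x ^ (A - ((k : ℝ) / 2 + 1))) ≠ 0 := by
  obtain ⟨c, hc0, hc⟩ := exists_lintegral_coneUnit_eq k
  rw [hc]
  exact mul_ne_zero (mul_ne_zero (mul_ne_zero hc0 (bracketInt_ne_zero _ _))
    (betaInt_ne_zero _ _)) (betaInt_ne_zero _ _)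

theorem lt_of_lintegral_coneUnit_lt_top (k : ℕ) {A C : ℝ}
    (h : ∫⁻ x in lCone (k + 2), ENNReal.ofReal (lDelta (k + 2) (coneUnit k + x) ^ (-C) *
        lDelta (k + 2) x ^ (A - ((k : ℝ) / 2 + 1))) < ⊤) :
    (k : ℝ) / 2 < A ∧ A < C - (k : ℝ) / 2 := by
  obtain ⟨c, hc0, hc⟩ := exists_lintegral_coneUnit_eq k
  rw [hc] at h
  have hcb := mul_ne_zero hc0 (bracketInt_ne_zero k C)
  have hb1 := betaInt_ne_zero A (C - (k : ℝ) / 2)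
  have hb2 := betaInt_ne_zero (A - (k : ℝ) / 2) (C - (k : ℝ) / 2)
  have h2 := ENNReal.lt_top_of_mul_ne_top_right h.ne (mul_ne_zero hcb hb1)
  have h1 := ENNReal.lt_top_of_mul_ne_top_right
    (ENNReal.lt_top_of_mul_ne_top_left h.ne hb2).ne hcb
  exact ⟨sub_pos.1 ((betaInt_lt_top_iff _ _).1 h2).1, ((betaInt_lt_top_iff _ _).1 h1).2⟩

/-- The order interval between `e / 2` and `2 e`. -/
def unitNhd (k : ℕ) : Set (Fin (k + 2) → ℝ) :=
  {x | x - (1 / 2 : ℝ) • coneUnit k ∈ lCone (k + 2) ∧ (2 : ℝ) • coneUnit k - x ∈ lCone (k + 2)}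

theorem half_coneUnit_mem (k : ℕ) : (1 / 2 : ℝ) • coneUnit k ∈ lCone (k + 2) :=
  (smul_mem_lCone_iff _ (by norm_num) _).2 (coneUnit_mem k)

theorem unitNhd_subset (k : ℕ) : unitNhd k ⊆ lCone (k + 2) := fun x hx => by
  have := add_mem_lCone k (half_coneUnit_mem k) hx.1
  rwa [add_sub_cancel] at this

theorem isOpen_unitNhd (k : ℕ) : IsOpen (unitNhd k) :=
  ((isOpen_lCone _).preimage (by fun_prop : Continuous fun x : Fin (k + 2) → ℝ =>
    x - (1 / 2 : ℝ) • coneUnit k)).inter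
  ((isOpen_lCone _).preimage (by fun_prop : Continuous fun x : Fin (k + 2) → ℝ =>
    (2 : ℝ) • coneUnit k - x))

theorem coneUnit_mem_unitNhd (k : ℕ) : coneUnit k ∈ unitNhd k := by
  constructor
  · convert half_coneUnit_mem k using 1
    module
  · convert coneUnit_mem k using 1
    module

theorem volume_unitNhd_ne_zero (k : ℕ) : volume (unitNhd k) ≠ 0 :=
  ((isOpen_unitNhd k).measure_pos _ ⟨_, coneUnit_mem_unitNhd k⟩).ne'

theorem volume_unitNhd_lt_top (k : ℕ) : volume (unitNhd k) < ⊤ := by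
  have hsub : unitNhd k ⊆ Metric.closedBall 0 3 := by
    intro x hx
    have hxc := unitNhd_subset k hx
    have h0 : x 0 < 2 := by
      have := hx.2.2
      simpa [coneUnit] using this
    have h0' := hxc.2
    have hd := hxc.1
    rw [lDelta] at hd
    rw [mem_closedBall_zero_iff, pi_norm_le_iff_of_nonneg (by norm_num)]
    intro i
    have := Finset.single_le_sum (f := fun i => x i ^ 2) (fun i _ => sq_nonneg _)
      (Finset.mem_univ i)
    rw [Real.norm_eq_abs]
    refine abs_le_of_sq_le_sq (by nlinarith) (by norm_num)
  exact (measure_mono hsub).trans_lt measure_closedBall_lt_top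

theorem lDelta_unitNhd (k : ℕ) {x : Fin (k + 2) → ℝ} (hx : x ∈ unitNhd k) :
    1 ≤ 4 * lDelta (k + 2) x ∧ lDelta (k + 2) x ≤ 4 := by
  constructor
  · have := lDelta_le_lDelta_add k (half_coneUnit_mem k) hx.1
    rw [add_sub_cancel, lDelta_smul, lDelta_coneUnit] at this
    linarith
  · have := lDelta_le_lDelta_add k (unitNhd_subset k hx) hx.2
    rw [add_sub_cancel, lDelta_smul, lDelta_coneUnit] at this
    linarith

theorem lDelta_add_unitNhd (k : ℕ) {x y : Fin (k + 2) → ℝ} (hx : x ∈ unitNhd k)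
    (hy : y ∈ lCone (k + 2)) :
    lDelta (k + 2) (coneUnit k + y) ≤ 4 * lDelta (k + 2) (x + y) ∧
      lDelta (k + 2) (x + y) ≤ 4 * lDelta (k + 2) (coneUnit k + y) := by
  have hhalf : (1 / 2 : ℝ) • y ∈ lCone (k + 2) := (smul_mem_lCone_iff _ (by norm_num) _).2 hy
  constructor
  · have h1 := lDelta_le_lDelta_add k (add_mem_lCone k (half_coneUnit_mem k) hhalf)
      (add_mem_lCone k hx.1 hhalf)
    have e1 : (1 / 2 : ℝ) • coneUnit k + (1 / 2 : ℝ) • y +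
        (x - (1 / 2 : ℝ) • coneUnit k + (1 / 2 : ℝ) • y) = x + y := by module
    rw [e1, ← smul_add, lDelta_smul] at h1
    linarith
  · have h1 := lDelta_le_lDelta_add k (add_mem_lCone k (unitNhd_subset k hx) hy)
      (add_mem_lCone k hx.2 hy)
    have e1 : x + y + ((2 : ℝ) • coneUnit k - x + y) = (2 : ℝ) • (coneUnit k + y) := by module
    rw [e1, lDelta_smul] at h1
    linarith

theorem rpow_lDelta_unitNhd_ge (k : ℕ) (E : ℝ) {x : Fin (k + 2) → ℝ} (hx : x ∈ unitNhd k) :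
    (4 : ℝ) ^ (-|E|) ≤ lDelta (k + 2) x ^ E := by
  have h := lDelta_unitNhd k hx
  have := rpow_le_mul_rpow_of_le_mul (c := 4) (by norm_num) (unitNhd_subset k hx).1 one_pos
    (by linarith) h.1 E
  rw [Real.one_rpow] at this
  rw [Real.rpow_neg (by norm_num), inv_le_iff_one_le_mul₀ (by positivity)]
  linarith

theorem rpow_lDelta_unitNhd_le (k : ℕ) (E : ℝ) {x : Fin (k + 2) → ℝ} (hx : x ∈ unitNhd k) :
    lDelta (k + 2) x ^ E ≤ (4 : ℝ) ^ |E| := by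
  have h := lDelta_unitNhd k hx
  have := rpow_le_mul_rpow_of_le_mul (c := 4) (by norm_num) one_pos (unitNhd_subset k hx).1
    h.1 (by linarith) E
  rwa [Real.one_rpow, mul_one] at this

theorem rpow_lDelta_add_unitNhd_ge (k : ℕ) (E : ℝ) {x y : Fin (k + 2) → ℝ} (hx : x ∈ unitNhd k)
    (hy : y ∈ lCone (k + 2)) :
    4 ^ (-|E|) * lDelta (k + 2) (coneUnit k + y) ^ E ≤ lDelta (k + 2) (x + y) ^ E := by
  have h := lDelta_add_unitNhd k hx hy
  have := rpow_le_mul_rpow_of_le_mul (c := 4) (by norm_num)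
    (add_mem_lCone k (unitNhd_subset k hx) hy).1 (add_mem_lCone k (coneUnit_mem k) hy).1
    h.2 h.1 E
  rw [Real.rpow_neg (by norm_num), inv_mul_le_iff₀ (by positivity)]
  exact this

/-- The indicator function of `unitNhd`. -/
def unitBump (k : ℕ) : (Fin (k + 2) → ℝ) → ℝ := (unitNhd k).indicator 1

theorem measurable_unitBump (k : ℕ) : Measurable (unitBump k) :=
  measurable_one.indicator (isOpen_unitNhd k).measurableSet

theorem coneNorm_unitBump_lt_top (k : ℕ) {p : ℝ} (hp : 0 < p) (ν : ℝ) :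
    coneNorm (k + 2) p ν (unitBump k) < ⊤ := by
  refine ENNReal.rpow_lt_top_of_nonneg (by positivity) (lt_of_le_of_lt (b := ∫⁻ y,
    (unitNhd k).indicator (fun _ => ENNReal.ofReal (4 ^ |ν - ((k + 2 : ℕ) : ℝ) / 2|)) y) ?_ ?_).ne
  · refine (setLIntegral_mono' (measurableSet_lCone _) fun y hy => ?_).trans
      (setLIntegral_le_lintegral _ _)
    by_cases hyB : y ∈ unitNhd k
    · rw [unitBump, Set.indicator_of_mem hyB, Set.indicator_of_mem hyB, Pi.one_apply, abs_one,
        Real.one_rpow, one_mul]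
      exact ENNReal.ofReal_le_ofReal (rpow_lDelta_unitNhd_le k _ hyB)
    · rw [unitBump, Set.indicator_of_notMem hyB, abs_zero, Real.zero_rpow hp.ne', zero_mul,
        ENNReal.ofReal_zero]
      exact zero_le
  · rw [lintegral_indicator (isOpen_unitNhd k).measurableSet, setLIntegral_const]
    exact ENNReal.mul_lt_top ENNReal.ofReal_lt_top (volume_unitNhd_lt_top k)

theorem exists_le_Sop_unitBump (k : ℕ) (α β γ : ℝ) : ∃ c : ℝ≥0∞, c ≠ 0 ∧ ∀ y ∈ lCone (k + 2),
    c * ENNReal.ofReal (lDelta (k + 2) (coneUnit k + y) ^ (-γ) * lDelta (k + 2) y ^ α) ≤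
      Sop (k + 2) α β γ (unitBump k) y := by
  refine ⟨ENNReal.ofReal (4 ^ (-|(-γ)|) * 4 ^ (-|β|)) * volume (unitNhd k),
    mul_ne_zero ?_ (volume_unitNhd_ne_zero k), fun y hy => ?_⟩
  · rw [ne_eq, ENNReal.ofReal_eq_zero, not_le]
    positivity
  have hy2 : 0 < lDelta (k + 2) y := hy.1
  have hey := (add_mem_lCone k (coneUnit_mem k) hy).1
  have hle : ENNReal.ofReal (lDelta (k + 2) (coneUnit k + y) ^ (-γ)) *
      (ENNReal.ofReal (4 ^ (-|(-γ)|) * 4 ^ (-|β|)) * volume (unitNhd k)) ≤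
      ∫⁻ x in lCone (k + 2), ENNReal.ofReal (lDelta (k + 2) (y + x) ^ (-γ) * |unitBump k x| *
        lDelta (k + 2) x ^ β) := by
    refine le_trans ?_ (lintegral_mono_set (unitNhd_subset k))
    rw [← mul_assoc, ← setLIntegral_const]
    refine setLIntegral_mono' (isOpen_unitNhd k).measurableSet fun x hx => ?_
    rw [unitBump, Set.indicator_of_mem hx, Pi.one_apply, abs_one, mul_one,
      ← ENNReal.ofReal_mul (by positivity)]
    refine ENNReal.ofReal_le_ofReal ?_
    have h1 := rpow_lDelta_add_unitNhd_ge k (-γ) hx hy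
    rw [add_comm x y] at h1
    have h2 := rpow_lDelta_unitNhd_ge k β hx
    calc _ = 4 ^ (-|(-γ)|) * lDelta (k + 2) (coneUnit k + y) ^ (-γ) * 4 ^ (-|β|) := by ring
      _ ≤ _ := mul_le_mul h1 h2 (by positivity) ((by positivity : (0:ℝ) ≤ _).trans h1)
  rw [ENNReal.ofReal_mul (p := lDelta (k + 2) (coneUnit k + y) ^ (-γ)) (by positivity), Sop]
  calc _ = ENNReal.ofReal (lDelta (k + 2) y ^ α) * (ENNReal.ofReal
      (lDelta (k + 2) (coneUnit k + y) ^ (-γ)) *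
      (ENNReal.ofReal (4 ^ (-|(-γ)|) * 4 ^ (-|β|)) * volume (unitNhd k))) := by ring
    _ ≤ _ := by gcongr

/-- The integral in the definition of `SopNorm` dominates the basic kernel integral. -/
theorem exists_le_lintegral_Sop_unitBump (k : ℕ) (α β γ μ : ℝ) {q : ℝ} (hq : 0 < q) :
    ∃ c : ℝ≥0∞, c ≠ 0 ∧
      c * ∫⁻ y in lCone (k + 2), ENNReal.ofReal (lDelta (k + 2) (coneUnit k + y) ^ (-(q * γ)) *
        lDelta (k + 2) y ^ (q * α + μ - ((k : ℝ) / 2 + 1))) ≤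
      ∫⁻ y in lCone (k + 2), Sop (k + 2) α β γ (unitBump k) y ^ q *
        ENNReal.ofReal (lDelta (k + 2) y ^ (μ - ((k + 2 : ℕ) : ℝ) / 2)) := by
  obtain ⟨c, hc0, hc⟩ := exists_le_Sop_unitBump k α β γ
  refine ⟨c ^ q, ?_, ?_⟩
  · rw [ne_eq, ENNReal.rpow_eq_zero_iff_of_pos hq]
    exact hc0
  rw [← lintegral_const_mul _ (by fun_prop)]
  refine setLIntegral_mono' (measurableSet_lCone _) fun y hy => ?_
  have hy2 : 0 < lDelta (k + 2) y := hy.1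
  have hey := (add_mem_lCone k (coneUnit_mem k) hy).1
  refine le_trans (le_of_eq ?_) (mul_le_mul_left (ENNReal.rpow_le_rpow (hc y hy) hq.le) _)
  rw [ENNReal.mul_rpow_of_nonneg _ _ hq.le, ENNReal.ofReal_rpow_of_nonneg (by positivity) hq.le,
    mul_assoc, ← ENNReal.ofReal_mul (by positivity)]
  congr 2
  have hn : ((k + 2 : ℕ) : ℝ) / 2 = (k : ℝ) / 2 + 1 := by push_cast; ring
  rw [Real.mul_rpow (by positivity) (by positivity), ← Real.rpow_mul hey.le,
    ← Real.rpow_mul hy2.le, hn, add_sub_assoc, Real.rpow_add hy2, mul_comm q α, mul_comm q γ,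
    neg_mul]
  ring

theorem target_conditions_of_sBounded (k : ℕ) {α β γ ν μ p q : ℝ} (hp : 0 < p) (hq : 0 < q)
    (h : SBounded (k + 2) α β γ p ν q μ) :
    (k : ℝ) / 2 < q * α + μ ∧ q * α + μ < q * γ - (k : ℝ) / 2 := by
  obtain ⟨C, -, hC⟩ := h
  have hfin := coneNorm_unitBump_lt_top k hp ν
  have hS := (hC _ (measurable_unitBump k) hfin).trans_lt
    (ENNReal.mul_lt_top ENNReal.ofReal_lt_top hfin)
  rw [SopNorm, ENNReal.rpow_lt_top_iff_of_pos (by positivity)] at hS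
  obtain ⟨c, hc0, hc⟩ := exists_le_lintegral_Sop_unitBump k α β γ μ hq
  exact lt_of_lintegral_coneUnit_lt_top k
    (ENNReal.lt_top_of_mul_ne_top_right (hc.trans_lt hS).ne hc0)

theorem exists_le_Sop_of_mem_unitNhd (k : ℕ) (α β γ : ℝ) : ∃ c : ℝ≥0∞, c ≠ 0 ∧ c ≠ ⊤ ∧
    ∀ g : (Fin (k + 2) → ℝ) → ℝ, Measurable g → ∀ y ∈ unitNhd k,
      c * ∫⁻ x in lCone (k + 2), ENNReal.ofReal (lDelta (k + 2) (coneUnit k + x) ^ (-γ) * |g x| *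
        lDelta (k + 2) x ^ β) ≤ Sop (k + 2) α β γ g y := by
  refine ⟨ENNReal.ofReal (4 ^ (-|α|)) * ENNReal.ofReal (4 ^ (-|(-γ)|)), ?_,
    ENNReal.mul_ne_top ENNReal.ofReal_ne_top ENNReal.ofReal_ne_top, fun g hg y hy => ?_⟩
  · refine mul_ne_zero ?_ ?_ <;> rw [ne_eq, ENNReal.ofReal_eq_zero, not_le] <;> positivity
  rw [Sop, mul_assoc]
  refine mul_le_mul' (ENNReal.ofReal_le_ofReal (rpow_lDelta_unitNhd_ge k α hy)) ?_
  rw [← lintegral_const_mul _ (by fun_prop)]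
  refine setLIntegral_mono' (measurableSet_lCone _) fun x hx => ?_
  have hx2 : 0 < lDelta (k + 2) x := hx.1
  rw [← ENNReal.ofReal_mul (by positivity)]
  refine ENNReal.ofReal_le_ofReal ?_
  have h1 := rpow_lDelta_add_unitNhd_ge k (-γ) hy hx
  rw [← mul_assoc, ← mul_assoc]
  gcongr

theorem exists_le_SopNorm (k : ℕ) (α β γ μ : ℝ) {q : ℝ} (hq : 0 < q) : ∃ c : ℝ≥0∞, c ≠ 0 ∧
    c ≠ ⊤ ∧ ∀ g : (Fin (k + 2) → ℝ) → ℝ, Measurable g →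
      c * ∫⁻ x in lCone (k + 2), ENNReal.ofReal (lDelta (k + 2) (coneUnit k + x) ^ (-γ) * |g x| *
        lDelta (k + 2) x ^ β) ≤ SopNorm (k + 2) α β γ q μ g := by
  obtain ⟨c, hc0, hct, hc⟩ := exists_le_Sop_of_mem_unitNhd k α β γ
  set E := μ - ((k + 2 : ℕ) : ℝ) / 2 with hE
  set d := ENNReal.ofReal (4 ^ (-|E|)) * volume (unitNhd k) with hd
  have hd0 : d ≠ 0 := by
    refine mul_ne_zero ?_ (volume_unitNhd_ne_zero k)
    rw [ne_eq, ENNReal.ofReal_eq_zero, not_le]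
    positivity
  have hdt : d ≠ ⊤ := ENNReal.mul_ne_top ENNReal.ofReal_ne_top (volume_unitNhd_lt_top k).ne
  refine ⟨c * d ^ (1 / q), mul_ne_zero hc0 ?_,
    ENNReal.mul_ne_top hct (ENNReal.rpow_ne_top_of_nonneg (by positivity) hdt), fun g hg => ?_⟩
  · rw [ne_eq, ENNReal.rpow_eq_zero_iff_of_pos (by positivity)]
    exact hd0
  set J := ∫⁻ x in lCone (k + 2), ENNReal.ofReal (lDelta (k + 2) (coneUnit k + x) ^ (-γ) * |g x| *
        lDelta (k + 2) x ^ β) with hJ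
  have h1 : (c * J) ^ q * d ≤ ∫⁻ y in lCone (k + 2), Sop (k + 2) α β γ g y ^ q *
        ENNReal.ofReal (lDelta (k + 2) y ^ E) := by
    refine le_trans ?_ (lintegral_mono_set (unitNhd_subset k))
    rw [hd, ← mul_assoc, ← setLIntegral_const]
    refine setLIntegral_mono' (isOpen_unitNhd k).measurableSet fun y hy => ?_
    exact mul_le_mul' (ENNReal.rpow_le_rpow (hc g hg y hy) hq.le)
      (ENNReal.ofReal_le_ofReal (rpow_lDelta_unitNhd_ge k E hy))
  calc c * d ^ (1 / q) * J = ((c * J) ^ q * d) ^ (1 / q) := by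
        rw [ENNReal.mul_rpow_of_nonneg ((c * J) ^ q) d (by positivity), ← ENNReal.rpow_mul,
          mul_one_div_cancel hq.ne', ENNReal.rpow_one]
        ring
    _ ≤ _ := ENNReal.rpow_le_rpow h1 (by positivity)

theorem source_conditions_of_sBounded (k : ℕ) {α β γ ν μ p p' q : ℝ} (hp : 1 < p)
    (hpp' : p' = p / (p - 1)) (hq : 0 < q) (h : SBounded (k + 2) α β γ p ν q μ) :
    (k : ℝ) / 2 < p' * (β + ((k : ℝ) / 2 + 1) - ν / p) ∧
      p' * (β + ((k : ℝ) / 2 + 1) - ν / p) < p' * γ - (k : ℝ) / 2 := by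
  have hp0 : 0 < p := by linarith
  have hp1 : p - 1 ≠ 0 := by linarith
  have hn : ((k + 2 : ℕ) : ℝ) / 2 = (k : ℝ) / 2 + 1 := by push_cast; ring
  obtain ⟨C, -, hC⟩ := h
  obtain ⟨c, hc0, hct, hc⟩ := exists_le_SopNorm k α β γ μ hq
  refine lt_of_lintegral_coneUnit_lt_top k ?_
  set m : ℝ := (k : ℝ) / 2 with hm
  refine lintegral_ofReal_lt_top_of_forall_le_rpow _ _ hp (D := c⁻¹ * ENNReal.ofReal C)
    (ENNReal.mul_ne_top (ENNReal.inv_ne_top.2 hc0) ENNReal.ofReal_ne_top) fun s hs hfin => ?_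
  set G : (Fin (k + 2) → ℝ) → ℝ := fun x => lDelta (k + 2) (coneUnit k + x) ^ (-(p' * γ)) *
    lDelta (k + 2) x ^ (p' * (β + (m + 1) - ν / p) - (m + 1)) with hG
  set g : (Fin (k + 2) → ℝ) → ℝ := s.indicator fun x =>
    lDelta (k + 2) (coneUnit k + x) ^ (-(γ * (p' - 1))) *
      lDelta (k + 2) x ^ ((β + (m + 1) - ν) * (p' - 1)) with hg
  have hgm : Measurable g := Measurable.indicator (by fun_prop) hs
  have hnorm : coneNorm (k + 2) p ν g =
      (∫⁻ x in s, ENNReal.ofReal (G x) ∂(volume.restrict (lCone (k + 2)))) ^ (1 / p) := by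
    rw [coneNorm, ← lintegral_indicator hs]
    congr 1
    refine setLIntegral_congr_fun (measurableSet_lCone _) fun x hx => ?_
    have hx2 : 0 < lDelta (k + 2) x := hx.1
    have hex := (add_mem_lCone k (coneUnit_mem k) hx).1
    by_cases hxs : x ∈ s
    · simp only [hg, hG, Set.indicator_of_mem hxs]
      rw [abs_of_nonneg (by positivity), Real.mul_rpow (by positivity) (by positivity),
        ← Real.rpow_mul hx2.le, ← Real.rpow_mul hex.le, mul_assoc, ← Real.rpow_add hx2, hn]
      congr 3
      · rw [hpp']; field_simp; ring
      · rw [hpp']; field_simp; ring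
    · simp only [hg, Set.indicator_of_notMem hxs]
      rw [abs_zero, Real.zero_rpow hp0.ne', zero_mul, ENNReal.ofReal_zero]
  have hJ : ∫⁻ x in lCone (k + 2), ENNReal.ofReal (lDelta (k + 2) (coneUnit k + x) ^ (-γ) * |g x| *
        lDelta (k + 2) x ^ β) =
      ∫⁻ x in s, ENNReal.ofReal (G x) ∂(volume.restrict (lCone (k + 2))) := by
    rw [← lintegral_indicator hs]
    refine setLIntegral_congr_fun (measurableSet_lCone _) fun x hx => ?_
    have hx2 : 0 < lDelta (k + 2) x := hx.1
    have hex := (add_mem_lCone k (coneUnit_mem k) hx).1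
    by_cases hxs : x ∈ s
    · simp only [hg, hG, Set.indicator_of_mem hxs]
      rw [abs_of_nonneg (by positivity), ← mul_assoc, ← Real.rpow_add hex, mul_assoc,
        ← Real.rpow_add hx2]
      congr 3
      · ring
      · rw [hpp']; field_simp; ring
    · simp only [hg, Set.indicator_of_notMem hxs]
      rw [abs_zero, mul_zero, zero_mul, ENNReal.ofReal_zero]
  have hb := (hc g hgm).trans (hC g hgm
    (by rw [hnorm]; exact ENNReal.rpow_lt_top_of_nonneg (by positivity) hfin.ne))
  rw [hJ, hnorm] at hb
  rw [mul_assoc, ← ENNReal.div_eq_inv_mul, ENNReal.le_div_iff_mul_le (Or.inl hc0) (Or.inl hct),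
    mul_comm]
  exact hb

theorem lintegral_lCone_eq_lintegral_smul (n : ℕ) [NeZero n] {t : ℝ} (ht : 0 < t)
    (f : (Fin n → ℝ) → ℝ≥0∞) :
    ∫⁻ x in lCone n, f x = ENNReal.ofReal (t ^ (n : ℝ)) * ∫⁻ x in lCone n, f (t • x) := by
  rw [← lintegral_indicator (measurableSet_lCone n),
    lintegral_eq_ofReal_mul_lintegral_comp_smul volume ht, Module.finrank_fin_fun,
    Real.rpow_natCast, ← lintegral_indicator (measurableSet_lCone n)]
  congr 2 with x
  by_cases hx : x ∈ lCone n
  · rw [Set.indicator_of_mem hx, Set.indicator_of_mem ((smul_mem_lCone_iff n ht x).2 hx)]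
  · rw [Set.indicator_of_notMem hx,
      Set.indicator_of_notMem fun h => hx ((smul_mem_lCone_iff n ht x).1 h)]

theorem rpow_lDelta_smul (n : ℕ) [NeZero n] {t : ℝ} (ht : 0 < t) {x : Fin n → ℝ}
    (hx : x ∈ lCone n) (E : ℝ) :
    lDelta n (t • x) ^ E = t ^ (2 * E) * lDelta n x ^ E := by
  rw [lDelta_smul, Real.mul_rpow (by positivity) hx.1.le, Real.rpow_mul ht.le, Real.rpow_two]

theorem coneNorm_eq_coneNorm_smul (n : ℕ) [NeZero n] {p : ℝ} (hp : 0 < p) (ν : ℝ) {t : ℝ}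
    (ht : 0 < t) (g : (Fin n → ℝ) → ℝ) :
    coneNorm n p ν g =
      ENNReal.ofReal (t ^ (2 * ν / p)) * coneNorm n p ν fun x => g (t • x) := by
  rw [coneNorm, lintegral_lCone_eq_lintegral_smul n ht, coneNorm]
  have h : ∫⁻ x in lCone n, ENNReal.ofReal
        (|g (t • x)| ^ p * lDelta n (t • x) ^ (ν - (n : ℝ) / 2)) =
      ENNReal.ofReal (t ^ (2 * (ν - (n : ℝ) / 2))) * ∫⁻ x in lCone n, ENNReal.ofReal
        (|g (t • x)| ^ p * lDelta n x ^ (ν - (n : ℝ) / 2)) := by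
    rw [← lintegral_const_mul' _ _ ENNReal.ofReal_ne_top]
    refine setLIntegral_congr_fun (measurableSet_lCone _) fun x hx => ?_
    rw [rpow_lDelta_smul n ht hx, ← ENNReal.ofReal_mul (by positivity), mul_left_comm]
  rw [h, ← mul_assoc, ← ENNReal.ofReal_mul (by positivity), ← Real.rpow_add ht,
    ENNReal.mul_rpow_of_nonneg _ _ (by positivity),
    ENNReal.ofReal_rpow_of_nonneg (by positivity) (by positivity), ← Real.rpow_mul ht.le]
  congr 3
  field_simp
  ring

theorem Sop_smul (n : ℕ) [NeZero n] (α β γ : ℝ) {t : ℝ} (ht : 0 < t)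
    (g : (Fin n → ℝ) → ℝ) {y : Fin n → ℝ} (hy : y ∈ lCone n)
    (hadd : ∀ x ∈ lCone n, y + x ∈ lCone n) :
    Sop n α β γ g (t • y) =
      ENNReal.ofReal (t ^ (2 * α + 2 * β - 2 * γ + n)) * Sop n α β γ (fun x => g (t • x)) y := by
  rw [Sop, lintegral_lCone_eq_lintegral_smul n ht, Sop]
  have h : ∫⁻ x in lCone n, ENNReal.ofReal
        (lDelta n (t • y + t • x) ^ (-γ) * |g (t • x)| * lDelta n (t • x) ^ β) =
      ENNReal.ofReal (t ^ (2 * β - 2 * γ)) * ∫⁻ x in lCone n, ENNReal.ofReal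
        (lDelta n (y + x) ^ (-γ) * |g (t • x)| * lDelta n x ^ β) := by
    rw [← lintegral_const_mul' _ _ ENNReal.ofReal_ne_top]
    refine setLIntegral_congr_fun (measurableSet_lCone _) fun x hx => ?_
    rw [← smul_add, rpow_lDelta_smul n ht hx, rpow_lDelta_smul n ht (hadd x hx),
      ← ENNReal.ofReal_mul (by positivity),
      show 2 * β - 2 * γ = 2 * -γ + 2 * β by ring, Real.rpow_add ht]
    congr 1
    ring
  rw [h, rpow_lDelta_smul n ht hy, ENNReal.ofReal_mul (by positivity),
    show 2 * α + 2 * β - 2 * γ + n = 2 * α + n + (2 * β - 2 * γ) by ring, Real.rpow_add ht,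
    Real.rpow_add ht, ENNReal.ofReal_mul (by positivity), ENNReal.ofReal_mul (by positivity)]
  ring

theorem SopNorm_eq_SopNorm_smul (k : ℕ) (α β γ μ : ℝ) {q : ℝ} (hq : 0 < q) {t : ℝ}
    (ht : 0 < t) (g : (Fin (k + 2) → ℝ) → ℝ) :
    SopNorm (k + 2) α β γ q μ g =
      ENNReal.ofReal (t ^ (2 * α + 2 * β - 2 * γ + (k + 2 : ℕ) + 2 * μ / q)) *
        SopNorm (k + 2) α β γ q μ fun x => g (t • x) := by
  rw [SopNorm, lintegral_lCone_eq_lintegral_smul (k + 2) ht, SopNorm]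
  set E := 2 * α + 2 * β - 2 * γ + (k + 2 : ℕ) with hE
  have h : ∫⁻ y in lCone (k + 2), Sop (k + 2) α β γ g (t • y) ^ q *
        ENNReal.ofReal (lDelta (k + 2) (t • y) ^ (μ - ((k + 2 : ℕ) : ℝ) / 2)) =
      ENNReal.ofReal (t ^ (E * q + 2 * (μ - ((k + 2 : ℕ) : ℝ) / 2))) *
        ∫⁻ y in lCone (k + 2), Sop (k + 2) α β γ (fun x => g (t • x)) y ^ q *
          ENNReal.ofReal (lDelta (k + 2) y ^ (μ - ((k + 2 : ℕ) : ℝ) / 2)) := by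
    rw [← lintegral_const_mul' _ _ ENNReal.ofReal_ne_top]
    refine setLIntegral_congr_fun (measurableSet_lCone _) fun y hy => ?_
    rw [Sop_smul (k + 2) α β γ ht g hy fun x hx => add_mem_lCone k hy hx, ← hE,
      rpow_lDelta_smul (k + 2) ht hy, ENNReal.mul_rpow_of_nonneg _ _ hq.le,
      ENNReal.ofReal_rpow_of_nonneg (by positivity) hq.le, ← Real.rpow_mul ht.le,
      Real.rpow_add ht, ENNReal.ofReal_mul (by positivity), ENNReal.ofReal_mul (by positivity)]
    ring
  rw [h, ← mul_assoc, ← ENNReal.ofReal_mul (by positivity), ← Real.rpow_add ht,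
    ENNReal.mul_rpow_of_nonneg _ _ (by positivity),
    ENNReal.ofReal_rpow_of_nonneg (by positivity) (by positivity), ← Real.rpow_mul ht.le]
  congr 3
  field_simp
  ring

theorem eq_zero_of_forall_le_mul_rpow {a b : ℝ≥0∞} (ha : a ≠ 0) (hb : b ≠ ⊤) {E : ℝ}
    (h : ∀ t : ℝ, 0 < t → a ≤ b * ENNReal.ofReal (t ^ E)) : E = 0 := by
  by_contra hE
  have hlim : Filter.Tendsto (fun s : ℝ => b * ENNReal.ofReal s) (nhdsWithin 0 (Set.Ioi 0))
      (nhds (b * ENNReal.ofReal 0)) :=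
    (ENNReal.Tendsto.const_mul (ENNReal.tendsto_ofReal Filter.tendsto_id) (Or.inr hb)).mono_left
      nhdsWithin_le_nhds
  rw [ENNReal.ofReal_zero, mul_zero] at hlim
  refine ha (nonpos_iff_eq_zero.1 (ge_of_tendsto hlim ?_))
  filter_upwards [self_mem_nhdsWithin] with s hs
  have := h (s ^ E⁻¹) (Real.rpow_pos_of_pos hs _)
  rwa [← Real.rpow_mul (le_of_lt hs), inv_mul_cancel₀ hE, Real.rpow_one] at this

theorem SopNorm_unitBump_ne_zero (k : ℕ) (α β γ μ : ℝ) {q : ℝ} (hq : 0 < q) :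
    SopNorm (k + 2) α β γ q μ (unitBump k) ≠ 0 := by
  obtain ⟨c, hc0, hc⟩ := exists_le_lintegral_Sop_unitBump k α β γ μ hq
  rw [SopNorm, ne_eq, ENNReal.rpow_eq_zero_iff_of_pos (by positivity)]
  intro h0
  rw [h0, nonpos_iff_eq_zero] at hc
  exact mul_ne_zero hc0 (lintegral_coneUnit_ne_zero k _ _) hc

theorem homogeneity_of_sBounded (k : ℕ) {α β γ ν μ p q : ℝ} (hp : 0 < p) (hq : 0 < q)
    (h : SBounded (k + 2) α β γ p ν q μ) :
    γ = α + β + ((k + 2 : ℕ) : ℝ) / 2 - ν / p + μ / q := by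
  obtain ⟨C, -, hC⟩ := h
  have hN := coneNorm_unitBump_lt_top k hp ν
  suffices 2 * α + 2 * β - 2 * γ + (k + 2 : ℕ) + 2 * μ / q + -(2 * ν / p) = 0 by
    rw [mul_div_assoc, mul_div_assoc] at this
    linarith
  refine eq_zero_of_forall_le_mul_rpow (SopNorm_unitBump_ne_zero k α β γ μ hq)
    (b := ENNReal.ofReal C * coneNorm (k + 2) p ν (unitBump k))
    (ENNReal.mul_ne_top ENNReal.ofReal_ne_top hN.ne) fun t ht => ?_
  have hnorm : coneNorm (k + 2) p ν (fun x => unitBump k (t • x)) =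
      ENNReal.ofReal (t ^ (-(2 * ν / p))) * coneNorm (k + 2) p ν (unitBump k) := by
    rw [coneNorm_eq_coneNorm_smul _ hp ν ht (unitBump k), ← mul_assoc,
      ← ENNReal.ofReal_mul (by positivity), ← Real.rpow_add ht, neg_add_cancel, Real.rpow_zero,
      ENNReal.ofReal_one, one_mul]
  have hb := hC _ ((measurable_unitBump k).comp (measurable_const_smul t))
    (hnorm.trans_lt (ENNReal.mul_lt_top ENNReal.ofReal_lt_top hN))
  change _ ≤ _ * coneNorm (k + 2) p ν (fun x => unitBump k (t • x)) at hb
  rw [SopNorm_eq_SopNorm_smul k α β γ μ hq ht, Real.rpow_add ht _ (-(2 * ν / p)),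
    ENNReal.ofReal_mul (by positivity)]
  refine (mul_le_mul_right hb _).trans (le_of_eq ?_)
  rw [hnorm]
  ring

/-- Theorem 2.1 of the paper on the rank-2 Lorentz cone. -/
theorem statement0 (n : ℕ) [NeZero n] (hn : 3 ≤ n) (α β γ ν μ p q : ℝ)
    (hp : 1 < p) (hpq : p ≤ q)
    (h : ν / (p / (p - 1)) + μ / q > 0) :
    SBounded n α β γ p ν q μ ↔
      (γ = α + β + (n : ℝ) / 2 - ν / p + μ / q ∧
        (p * (β - γ + (n : ℝ) - 1) - (n : ℝ) / 2 + 1 < ν ∧ ν < p * (β + 1) + (n : ℝ) / 2 - 1) ∧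
        ((n : ℝ) / 2 - 1 - q * α < μ ∧ μ < q * (γ - α) - (n : ℝ) / 2 + 1)) := by
  obtain ⟨k, rfl⟩ := Nat.exists_eq_add_of_le' (show 2 ≤ n by omega)
  have hp0 : 0 < p := by linarith
  have hp1 : 0 < p - 1 := by linarith
  have hq : 0 < q := by linarith
  have hp' : 0 < p / (p - 1) := by positivity
  have hcast : ((k + 2 : ℕ) : ℝ) = k + 2 := by push_cast; ring
  have hsrc (a : ℝ) : (k : ℝ) / 2 < p / (p - 1) * a ↔ (p - 1) * ((k : ℝ) / 2) < p * a := by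
    rw [div_mul_eq_mul_div, lt_div_iff₀ hp1, mul_comm]
  have hνp : p * (ν / p) = ν := mul_div_cancel₀ _ hp0.ne'
  have hμq : q * (μ / q) = μ := mul_div_cancel₀ _ hq.ne'
  constructor
  · intro hS
    have h1 := homogeneity_of_sBounded k hp0 hq hS
    obtain ⟨h2, h3⟩ := target_conditions_of_sBounded k hp0 hq hS
    obtain ⟨h4, h5⟩ := source_conditions_of_sBounded k hp rfl hq hS
    have h6 : (k : ℝ) / 2 < p / (p - 1) * (γ - (β + ((k : ℝ) / 2 + 1) - ν / p)) := by
      rw [mul_sub]; linarith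
    rw [hsrc] at h4 h6
    refine ⟨h1, ⟨?_, ?_⟩, ?_, ?_⟩ <;> rw [hcast] <;> nlinarith
  · rintro ⟨h1, ⟨h2, h3⟩, h4, h5⟩
    rw [hcast] at h1 h2 h3 h4 h5
    have hsub : γ - (α + μ / q) = β + ((k : ℝ) / 2 + 1) - ν / p := by rw [h1]; ring
    refine sBounded_of_lt k hp0 hp' (by field_simp; ring) hpq (by rw [h1]; ring) ?_ ?_ ?_ ?_
    · rw [div_lt_iff₀' hq]; nlinarith
    · rw [div_lt_iff₀' hp', hsrc, ← sub_sub_cancel γ (α + μ / q), hsub]; nlinarith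
    · rw [div_lt_iff₀' hq, ← hsub]; nlinarith
    · rw [div_lt_iff₀' hp', hsrc]; nlinarith
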